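/- arXiv:1508.04597 — 3 statements merged into one kernel-verified Lean document; each statement's English description precedes it below -/
import Mathlib

section
/- Let (R, m) be a Noetherian local ring and x ∈ R a non-zerodivisor such that R/x^nR is quasi-Gorenstein for every positive integer n. Then R is quasi-Gorenstein. -/
open CategoryTheory IsLocalRing Pointwise

noncomputable section

/-- `E` is an injective hull of `S ⧸ J` over `S`. -/
def IsInjHull (S : Type) [CommRing S] (J : Ideal S) (E : Type) [AddCommGroup E]
    [Module S E] : Prop :=
  Module.Injective S E ∧
    ∃ f : (S ⧸ J) →ₗ[S] E, Function.Injective f ∧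
      ∀ N : Submodule S E, N ≠ ⊥ → N ⊓ LinearMap.range f ≠ ⊥

/-- Local cohomology `H^i_J(M)`. -/
abbrev LC (S : Type) [CommRing S] (J : Ideal S) (i : ℕ) (M : ModuleCat S) : ModuleCat S :=
  (localCohomology J i).obj M

/-- Krull dimension of a module (dimension of its support). -/
def mdim (S : Type) [CommRing S] (M : Type) [AddCommGroup M] [Module S M] : WithBot ℕ∞ :=
  Order.krullDim (Module.support S M)

/-- Depth/grade of an ideal `J` on `M`: supremum of lengths of `M`-regular sequences in `J`. -/
def gradeI (S : Type) [CommRing S] (J : Ideal S) (M : Type) [AddCommGroup M]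
    [Module S M] : ℕ∞ :=
  sSup {n : ℕ∞ | ∃ rs : List S, (rs.length : ℕ∞) = n ∧ (∀ r ∈ rs, r ∈ J) ∧
    RingTheory.Sequence.IsRegular M rs}

/-- The local "height" of `M` at a prime `p`, i.e. `dim_{S_p} M_p`. -/
def htM (S : Type) [CommRing S] (M : Type) [AddCommGroup M] [Module S M]
    (p : PrimeSpectrum S) : WithBot ℕ∞ :=
  mdim (Localization.AtPrime p.asIdeal) (LocalizedModule p.asIdeal.primeCompl M)

/-- `ht_M(a) = inf { dim_{S_p} M_p : p ⊇ a, p ∈ Supp M }`. -/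
def htI (S : Type) [CommRing S] (M : Type) [AddCommGroup M] [Module S M]
    (a : Ideal S) : WithBot ℕ∞ :=
  sInf {d | ∃ p ∈ Module.support S M, a ≤ p.asIdeal ∧ d = htM S M p}

/-- Serre's condition `S_n` for the module `M`. -/
def Serre (S : Type) [CommRing S] (n : ℕ) (M : Type) [AddCommGroup M] [Module S M] : Prop :=
  ∀ (p : Ideal S) [p.IsPrime],
    min (n : WithBot ℕ∞)
        (mdim (Localization.AtPrime p) (LocalizedModule p.primeCompl M)) ≤
      (gradeI (Localization.AtPrime p) (IsLocalRing.maximalIdeal (Localization.AtPrime p))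
        (LocalizedModule p.primeCompl M) : ℕ∞)

/-- Attached primes of `M` (Macdonald): primes of the form `Ann(M ⧸ N)`. -/
def attachedPrimes (S : Type) [CommRing S] (M : Type) [AddCommGroup M] [Module S M] :
    Set (Ideal S) :=
  {p | p.IsPrime ∧ ∃ N : Submodule S M, p = Module.annihilator S (M ⧸ N)}

/-- `ω` is a canonical module of the `d`-dimensional module `M` over `(S, J)`:
its "Matlis dual" `Hom_S(ω, E)` is isomorphic to `H^d_J(M)`. -/
def IsCanonicalModule (S : Type) [CommRing S] (J : Ideal S) (d : ℕ)
    (M ω : ModuleCat S) : Prop :=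
  Module.Finite S ω ∧ ∃ E : ModuleCat S, IsInjHull S J ↥E ∧
    Nonempty ((↥ω →ₗ[S] ↥E) ≃ₗ[S] ↥(LC S J d M))

/-- `(S, J)` is quasi-Gorenstein: `H^d_J(S)` is an injective hull of `S ⧸ J`, `d = dim S`. -/
def IsQuasiGorensteinAt (S : Type) [CommRing S] (J : Ideal S) : Prop :=
  ∃ d : ℕ, ringKrullDim S = (d : WithBot ℕ∞) ∧
    ∃ E : ModuleCat S, IsInjHull S J ↥E ∧
      Nonempty (↥(LC S J d (ModuleCat.of S S)) ≃ₗ[S] ↥E)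

/-- Totally reflexive modules. -/
def TotallyReflexive (S : Type) [CommRing S] (M : ModuleCat S) : Prop :=
  Module.Finite S ↥M ∧ Module.IsReflexive S ↥M ∧
    ∀ i : ℕ, 0 < i →
      Subsingleton ↥(((Ext S (ModuleCat S) i).obj (Opposite.op M)).obj (ModuleCat.of S S)) ∧
      Subsingleton ↥(((Ext S (ModuleCat S) i).obj
        (Opposite.op (ModuleCat.of S (Module.Dual S ↥M)))).obj (ModuleCat.of S S))

/-- `G`-dimension at most `n`. -/
def GdimLE (S : Type) [CommRing S] : ℕ → ModuleCat S → Prop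
  | 0, M => TotallyReflexive S M
  | n + 1, M => ∃ (G : ModuleCat S) (f : ↥G →ₗ[S] ↥M), Function.Surjective f ∧
      TotallyReflexive S G ∧ GdimLE S n (ModuleCat.of S (LinearMap.ker f))

/-- Injective dimension at most `n`. -/
def InjDimLE (S : Type) [CommRing S] : ℕ → ModuleCat S → Prop
  | 0, M => Module.Injective S ↥M
  | n + 1, M => ∃ (E : ModuleCat S) (f : ↥M →ₗ[S] ↥E), Function.Injective f ∧
      Module.Injective S ↥E ∧ InjDimLE S n (ModuleCat.of S (↥E ⧸ LinearMap.range f))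

/-- Injective dimension, as an element of `ℕ∞`. -/
def injDim (S : Type) [CommRing S] (M : ModuleCat S) : ℕ∞ :=
  sInf {n : ℕ∞ | ∃ k : ℕ, (k : ℕ∞) = n ∧ InjDimLE S k M}

/-- Minimal number of generators. -/
def genNumber (S : Type) [CommRing S] (M : Type) [AddCommGroup M] [Module S M] : ℕ∞ :=
  sInf {n : ℕ∞ | ∃ s : Finset M, (s.card : ℕ∞) = n ∧ Submodule.span S (↑s : Set M) = ⊤}

/-- The socle `0 :_M J`. -/
def socle (S : Type) [CommRing S] (J : Ideal S) (M : Type) [AddCommGroup M] [Module S M] :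
    Submodule S M :=
  ⨅ r ∈ J, LinearMap.ker (LinearMap.lsmul S M r)

/-- Limit closure of the sequence `x` on `M`. -/
def limClo (S : Type) [CommRing S] {v : ℕ} (x : Fin v → S) (M : Type) [AddCommGroup M]
    [Module S M] : Submodule S M :=
  ⨆ t : ℕ, (Ideal.span (Set.range fun i => x i ^ (t + 1)) • (⊤ : Submodule S M)).comap
      (LinearMap.lsmul S M ((∏ i, x i) ^ t))

end

/-- Krull dimension of a ring, valued in `WithBot ℕ∞`. -/
noncomputable def rdim (S : Type) [CommRing S] : WithBot ℕ∞ :=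
  Order.krullDim (PrimeSpectrum S)

namespace CategoryTheory.ProjectiveResolution
open Abelian

section
universe w v u
variable {C : Type u} [Category.{v} C] [Abelian C] [HasExt.{w} C]
  {X Y : C} (P : ProjectiveResolution X)

lemma extMk_zero_eq_zero_iff (f : P.complex.X 0 ⟶ Y) (m : ℕ) (hm : 0 + 1 = m)
    (hf : P.complex.d m 0 ≫ f = 0) : P.extMk f m hm hf = 0 ↔ f = 0 := by
  refine ⟨fun h ↦ ?_, fun h ↦ by subst h; simp⟩
  simp only [← P.extEquivCohomologyClass.apply_eq_iff_eq,
    extEquivCohomologyClass_extMk, extEquivCohomologyClass_zero,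
    CochainComplex.HomComplex.CohomologyClass.mk_eq_zero_iff] at h
  rw [CochainComplex.HomComplex.Cocycle.toSingleMk_mem_coboundaries_iff _ _ _ _ _ 1 (by lia)] at h
  obtain ⟨g, hg⟩ := h
  have : P.cochainComplex.d (-(0:ℕ) : ℤ) 1 = 0 := by
    apply Limits.IsZero.eq_of_tgt
    exact P.cochainComplex.isZero_of_isStrictlyLE 0 1 (by lia)
  rw [this, Limits.zero_comp] at hg
  simpa using hg.symm

lemma extMk_smul {A : Type*} [CommRing A] [Linear A C] {n : ℕ} (a : A) (f : P.complex.X n ⟶ Y)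
    (m : ℕ) (hm : n + 1 = m) (hf : P.complex.d m n ≫ f = 0) :
    P.extMk (a • f) m hm (by simp [hf]) = a • P.extMk f m hm hf := by
  rw [Ext.smul_eq_comp_mk₀, extMk_comp_mk₀]
  congr 1
  simp
end

section
universe u
variable {A : Type u} [CommRing A] {X Y : ModuleCat.{u} A} (P : ProjectiveResolution X)

/-- Cocycles of degree `n`. -/
def cocycles (Y : ModuleCat.{u} A) (n : ℕ) : Submodule A (P.complex.X n ⟶ Y) :=
  LinearMap.ker (Linear.leftComp A Y (P.complex.d (n + 1) n))

/-- The class of a cocycle. -/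
noncomputable def extClass (n : ℕ) : P.cocycles Y n →ₗ[A] Abelian.Ext.{u} X Y n where
  toFun f := P.extMk f.1 (n + 1) rfl f.2
  map_add' f g := (P.add_extMk f.1 g.1 (n + 1) rfl f.2 g.2).symm
  map_smul' a f := P.extMk_smul a f.1 (n + 1) rfl f.2

lemma extClass_surjective (n : ℕ) : Function.Surjective (P.extClass (Y := Y) n) := fun α ↦ by
  obtain ⟨f, hf, h⟩ := P.extMk_surjective α (n + 1) rfl
  exact ⟨⟨f, hf⟩, h⟩

/-- The identification of abstract cycles with cocycles. -/
noncomputable def cyclesToCocycles (n : ℕ) :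
    (P.complex.linearYonedaObj A Y).cycles n →ₗ[A] P.cocycles Y n :=
  LinearMap.codRestrict (P.cocycles Y n) ((P.complex.linearYonedaObj A Y).iCycles n).hom fun z ↦
    ConcreteCategory.congr_hom ((P.complex.linearYonedaObj A Y).iCycles_d n (n + 1)) z

lemma coe_cyclesToCocycles (n : ℕ) (z : (P.complex.linearYonedaObj A Y).cycles n) :
    (P.cyclesToCocycles n z : P.complex.X n ⟶ Y) =
      (P.complex.linearYonedaObj A Y).iCycles n z := rfl

lemma cyclesToCocycles_surjective (n : ℕ) :
    Function.Surjective (P.cyclesToCocycles (Y := Y) n) := fun f ↦ by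
  let K := P.complex.linearYonedaObj A Y
  let k : ModuleCat.of A (P.cocycles Y n) ⟶ K.X n := ModuleCat.ofHom (Submodule.subtype _)
  have hk : k ≫ K.d n (n + 1) = 0 := by
    ext z
    exact z.2
  refine ⟨K.liftCycles k (n + 1) (by simp) hk f, Subtype.ext ?_⟩
  rw [coe_cyclesToCocycles]
  exact ConcreteCategory.congr_hom (K.liftCycles_i k (n + 1) (by simp) hk) f

lemma extClass_eq_zero_iff {n : ℕ} (z : (P.complex.linearYonedaObj A Y).cycles n) :
    P.extClass n (P.cyclesToCocycles n z) = 0 ↔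
      (P.complex.linearYonedaObj A Y).homologyπ n z = 0 := by
  let K := P.complex.linearYonedaObj A Y
  have hex : ∀ i, (ComplexShape.up ℕ).prev n = i → (K.homologyπ n z = 0 ↔
      ∃ g : P.complex.X i ⟶ Y, P.complex.d n i ≫ g = K.iCycles n z) := fun i hi ↦ by
    have hS := ShortComplex.exact_of_g_is_cokernel
      (ShortComplex.mk _ _ (K.toCycles_comp_homologyπ i n)) (K.homologyIsCokernel i n hi)
    have hinj : Function.Injective (K.iCycles n) :=
      (ModuleCat.mono_iff_injective _).1 inferInstance
    have hto (g : P.complex.X i ⟶ Y) :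
        K.iCycles n (K.toCycles i n g) = P.complex.d n i ≫ g :=
      ConcreteCategory.congr_hom (K.toCycles_i i n) g
    constructor
    · intro h
      obtain ⟨g, hg⟩ := (ShortComplex.moduleCat_exact_iff _).1 hS z h
      exact ⟨g, (hto g).symm.trans (congrArg (K.iCycles n) hg)⟩
    · rintro ⟨g, hg⟩
      obtain rfl : K.toCycles i n g = z := hinj ((hto g).trans hg)
      exact ConcreteCategory.congr_hom (K.toCycles_comp_homologyπ i n) g
  rcases n with - | p
  · refine (P.extMk_zero_eq_zero_iff _ (0 + 1) rfl (P.cyclesToCocycles 0 z).2).trans ?_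
    rw [hex 0 (by simp), coe_cyclesToCocycles]
    refine ⟨fun h ↦ ⟨0, ?_⟩, fun ⟨g, hg⟩ ↦ ?_⟩
    · rw [h, Limits.comp_zero]
    · rw [← hg, HomologicalComplex.shape _ _ _ (by simp), Limits.zero_comp]
  · refine (P.extMk_eq_zero_iff _ (p + 1 + 1) rfl (P.cyclesToCocycles (p + 1) z).2 p rfl).trans ?_
    rw [hex p (by simp), coe_cyclesToCocycles]

/-- The comparison of the derived functor `Ext` with Yoneda `Ext`, in terms of a projective
resolution. -/
noncomputable def homologyLinearEquiv (n : ℕ) :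
    (P.complex.linearYonedaObj A Y).homology n ≃ₗ[A] Abelian.Ext.{u} X Y n :=
  have hπ : Function.Surjective ((P.complex.linearYonedaObj A Y).homologyπ n).hom :=
    (ModuleCat.epi_iff_surjective _).1 inferInstance
  have hk : LinearMap.ker ((P.complex.linearYonedaObj A Y).homologyπ n).hom =
      LinearMap.ker (P.extClass (Y := Y) n ∘ₗ P.cyclesToCocycles n) := by
    ext z
    exact (P.extClass_eq_zero_iff z).symm
  (LinearMap.quotKerEquivOfSurjective _ hπ).symm ≪≫ₗ
    Submodule.quotEquivOfEq _ _ hk ≪≫ₗ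
    LinearMap.quotKerEquivOfSurjective _
      ((P.extClass_surjective n).comp (P.cyclesToCocycles_surjective n))

lemma homologyLinearEquiv_homologyπ (n : ℕ) (z : (P.complex.linearYonedaObj A Y).cycles n) :
    P.homologyLinearEquiv n ((P.complex.linearYonedaObj A Y).homologyπ n z) =
      P.extClass n (P.cyclesToCocycles n z) := by
  have hπ : Function.Surjective ((P.complex.linearYonedaObj A Y).homologyπ n).hom :=
    (ModuleCat.epi_iff_surjective _).1 inferInstance
  have : (LinearMap.quotKerEquivOfSurjective _ hπ).symm
      ((P.complex.linearYonedaObj A Y).homologyπ n z) = Submodule.Quotient.mk z := by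
    rw [LinearEquiv.symm_apply_eq]
    rfl
  simp only [homologyLinearEquiv, LinearEquiv.trans_apply]
  erw [this]
  rfl

variable {X' : ModuleCat.{u} A} (P' : ProjectiveResolution X') (g : X' ⟶ X)

/-- The morphism of complexes induced by precomposition with a morphism of resolutions. -/
noncomputable def linearYonedaMap {g : X' ⟶ X} (φ : Hom P' P g) (Y : ModuleCat.{u} A) :
    P.complex.linearYonedaObj A Y ⟶ P'.complex.linearYonedaObj A Y :=
  (HomologicalComplex.unopFunctor _ _).map
    ((((linearYoneda A _).obj Y).rightOp.mapHomologicalComplex _).map φ.hom).op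

variable {P P' g}

lemma homologyLinearEquiv_naturality (φ : Hom P' P g) (n : ℕ)
    (a : (P.complex.linearYonedaObj A Y).homology n) :
    P'.homologyLinearEquiv n (HomologicalComplex.homologyMap (linearYonedaMap P P' φ Y) n a) =
      (Ext.mk₀ g).comp (P.homologyLinearEquiv n a) (zero_add n) := by
  have hπ : Function.Surjective ((P.complex.linearYonedaObj A Y).homologyπ n).hom :=
    (ModuleCat.epi_iff_surjective _).1 inferInstance
  obtain ⟨z, rfl⟩ := hπ a
  have h1 := ConcreteCategory.congr_hom
    (HomologicalComplex.homologyπ_naturality (linearYonedaMap P P' φ Y) n) z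
  have h2 := ConcreteCategory.congr_hom
    (HomologicalComplex.cyclesMap_i (linearYonedaMap P P' φ Y) n) z
  have h3 : P'.cyclesToCocycles n (HomologicalComplex.cyclesMap (linearYonedaMap P P' φ Y) n z) =
      (φ.hom.f n ≫ (P.cyclesToCocycles n z).1 : P'.complex.X n ⟶ Y) := h2
  refine (congrArg (P'.homologyLinearEquiv n) h1).trans ?_
  refine (P'.homologyLinearEquiv_homologyπ n _).trans ?_
  refine Eq.trans ?_ (congrArg (fun t ↦ (Ext.mk₀ g).comp t (zero_add n))
    (P.homologyLinearEquiv_homologyπ n z)).symm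
  refine Eq.trans ?_ (mk₀_comp_extMk (R := P) (P.cyclesToCocycles n z).1 (n + 1) rfl
    (P.cyclesToCocycles n z).2 φ).symm
  have h4 (c : P'.cocycles Y n) (f : P'.complex.X n ⟶ Y) (hf) (h : c.1 = f) :
      P'.extClass n c = P'.extMk f (n + 1) rfl hf := by subst h; rfl
  exact h4 _ _ _ h3

lemma comp_trans_symm_hom {D : Type*} [Category* D] {U U' V V' W W' : D} (F : U ⟶ U')
    (a : U ≅ V) (a' : U' ≅ V') (G : V ⟶ V') (b : W ≅ V) (b' : W' ≅ V') (M : W ⟶ W')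
    (h : F ≫ a'.hom = a.hom ≫ G) (h' : b.hom ≫ G = M ≫ b'.hom) :
    F ≫ (a' ≪≫ b'.symm).hom = (a ≪≫ b.symm).hom ≫ M := by
  have h'' : G ≫ b'.inv = b.inv ≫ M := by rw [Iso.comp_inv_eq, Category.assoc, ← h']; simp
  simp [reassoc_of% h, h'']

lemma isoExt_naturality (φ : Hom P' P g) (n : ℕ) :
    ((_root_.Ext A (ModuleCat.{u} A) n).map g.op).app Y ≫ (P'.isoExt n Y).hom =
      (P.isoExt n Y).hom ≫ HomologicalComplex.homologyMap (linearYonedaMap P P' φ Y) n := by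
  have h1 := congrArg Quiver.Hom.unop (isoLeftDerivedObj_inv_naturality g P' P φ.hom
    (by simpa using φ.hom_f_zero_comp_π_f_zero) ((linearYoneda A _).obj Y).rightOp n)
  have h2 := congrArg Quiver.Hom.unop
    (HomologicalComplex.homologyOp_hom_naturality (linearYonedaMap P P' φ Y) n)
  have h3 : (HomologicalComplex.homologyUnop _ n).hom ≫
      ((((linearYoneda A _).obj Y).rightOp.mapHomologicalComplex _ ⋙
        HomologicalComplex.homologyFunctor _ _ n).map φ.hom).unop =
      HomologicalComplex.homologyMap (linearYonedaMap P P' φ Y) n ≫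
        (HomologicalComplex.homologyUnop _ n).hom := h2
  exact comp_trans_symm_hom _ _ _ _ _ _ _ h1 h3

variable (A) in
/-- The comparison of the derived functor `Ext` with Yoneda `Ext`. -/
noncomputable def _root_.CategoryTheory.Abelian.Ext.derivedEquiv (X Y : ModuleCat.{u} A) (n : ℕ) :
    ((_root_.Ext A (ModuleCat.{u} A) n).obj (.op X)).obj Y ≃ₗ[A] Abelian.Ext.{u} X Y n :=
  (((projectiveResolution X).isoExt n Y).toLinearEquiv).trans
    ((projectiveResolution X).homologyLinearEquiv n)

lemma _root_.CategoryTheory.Abelian.Ext.derivedEquiv_naturality {X X' : ModuleCat.{u} A}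
    (g : X' ⟶ X) (Y : ModuleCat.{u} A) (n : ℕ)
    (a : ((_root_.Ext A (ModuleCat.{u} A) n).obj (.op X)).obj Y) :
    Ext.derivedEquiv A X' Y n (((_root_.Ext A (ModuleCat.{u} A) n).map g.op).app Y a) =
      (Ext.mk₀ g).comp (Ext.derivedEquiv A X Y n a) (zero_add n) := by
  let φ : Hom (projectiveResolution X') (projectiveResolution X) g :=
    ⟨lift g _ _, (lift_commutes_zero g _ _).trans (by simp [ChainComplex.single₀_map_f_zero])⟩
  exact (congrArg _ (ConcreteCategory.congr_hom (isoExt_naturality (Y := Y) φ n) a)).trans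
    (homologyLinearEquiv_naturality φ n _)

end
end CategoryTheory.ProjectiveResolution

namespace ReesExt
open Abelian ModuleCat
universe u
variable {R S : Type u} [CommRing R] [CommRing S] {f : R →+* S}

section free
variable {ι : Type u} {P : ModuleCat.{u} S} (b : Module.Basis ι S P)

/-- The free `R`-module on a basis of an `S`-module `P`, mapping to `P`. -/
noncomputable def freeCover : (ι →₀ R) →ₗ[R] (restrictScalars f).obj P :=
  Finsupp.linearCombination R (M := (restrictScalars f).obj P) (b : ι → P)

lemma repr_freeCover (v : ι →₀ R) (i : ι) : b.repr (freeCover (f := f) b v : P) i = f (v i) := by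
  induction v using Finsupp.induction_linear with
  | zero =>
    rw [map_zero, Finsupp.zero_apply, map_zero]
    erw [map_zero]
    rfl
  | add v w hv hw =>
    rw [map_add, Finsupp.add_apply, map_add, ← hv, ← hw]
    erw [map_add]
    rfl
  | single j r =>
    have : freeCover (f := f) b (Finsupp.single j r) = (f r • b j : P) := by
      unfold freeCover
      erw [Finsupp.linearCombination_single]
      rfl
    classical
    rw [this, map_smul, Finsupp.smul_apply, b.repr_self, Finsupp.single_apply, Finsupp.single_apply]
    split_ifs <;> simp

variable (hf : Function.Surjective f) {y : R} (hy : IsSMulRegular R y)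
  (hker : ∀ r, f r = 0 ↔ y ∣ r)

include hf hy hker in
lemma freeCover_shortExact :
    ∃ w, (ShortComplex.mk (ModuleCat.ofHom (y • LinearMap.id : (ι →₀ R) →ₗ[R] (ι →₀ R)))
      (ModuleCat.ofHom (Y := (restrictScalars f).obj P) (freeCover (f := f) b)) w).ShortExact := by
  refine ⟨?_, @ShortComplex.ShortExact.mk _ _ _ _ ?_ ?_ ?_⟩
  · ext : 1
    refine LinearMap.ext fun v ↦ ?_
    refine b.repr.injective (Finsupp.ext fun i ↦ ?_)
    refine (repr_freeCover b _ _).trans ?_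
    refine Eq.trans ?_ (congrArg (· i) b.repr.map_zero).symm
    exact (hker _).2 ⟨v i, rfl⟩
  · rw [ShortComplex.moduleCat_exact_iff]
    intro v hv
    change freeCover (f := f) b v = 0 at hv
    have hv' (i) : y ∣ v i := by
      rw [← hker, ← repr_freeCover b, hv]
      exact (congrArg (· i) b.repr.map_zero)
    choose w hw using hv'
    refine ⟨Finsupp.onFinset v.support w fun i hi ↦ ?_, ?_⟩
    · rw [Finsupp.mem_support_iff]
      contrapose! hi
      refine hy ?_
      simp only [smul_eq_mul, mul_zero]
      rw [← hw, hi]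
    · refine Finsupp.ext fun i ↦ ?_
      exact (hw i).symm
  · refine (ModuleCat.mono_iff_injective _).2 fun v w h ↦ Finsupp.ext fun i ↦ hy ?_
    exact DFunLike.congr_fun h i
  · classical
    refine (ModuleCat.epi_iff_surjective _).2 fun p ↦ ?_
    choose s hs using hf
    refine ⟨Finsupp.onFinset (b.repr p).support (fun i ↦ if b.repr p i = 0 then 0 else
      s (b.repr p i)) fun i hi ↦ ?_, b.repr.injective (Finsupp.ext fun i ↦ ?_)⟩
    · rw [Finsupp.mem_support_iff]
      contrapose! hi
      simp [hi]
    · refine (repr_freeCover b _ _).trans ?_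
      simp only [Finsupp.onFinset_apply]
      split_ifs with h
      · simp [h]
      · rw [hs]

include b hf hy hker in
lemma ext_free_eq_zero {n : ℕ} (a : Ext.{u} ((restrictScalars f).obj P) (of R R) (n + 2)) :
    a = 0 := by
  obtain ⟨w, h⟩ := freeCover_shortExact b hf hy hker
  have : Projective (of R (ι →₀ R)) := inferInstance
  obtain ⟨c, rfl⟩ := Ext.contravariant_sequence_exact₃ h _ a
    (Ext.eq_zero_of_projective _) (n₀ := n + 1) (by lia)
  rw [Ext.eq_zero_of_projective c, Ext.comp_zero]

end free

variable (f) in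
/-- The quotient map as a map of modules. -/
def quotMap : R →ₗ[R] (restrictScalars f).obj (of S S) where
  toFun r := (f r : S)
  map_add' := map_add f
  map_smul' := map_mul f

variable (hf : Function.Surjective f) {y : R} (hy : IsSMulRegular R y)
  (hker : ∀ r, f r = 0 ↔ y ∣ r)

variable (f y) in
/-- The complex `R ⟶ R ⟶ R / y`. -/
noncomputable abbrev quotComplex (w : (y • 𝟙 (of R R)) ≫ ModuleCat.ofHom (quotMap f) = 0) :
    ShortComplex (ModuleCat.{u} R) :=
  ShortComplex.mk (X₁ := of R R) (X₂ := of R R) (y • 𝟙 (of R R)) (ModuleCat.ofHom (quotMap f)) w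

include hker in
lemma quotComplex_zero :
    (y • 𝟙 (of R R)) ≫ ModuleCat.ofHom (quotMap f) = 0 := by
  ext : 1
  refine LinearMap.ext fun r ↦ (hker (y * r)).2 ?_
  exact ⟨r, rfl⟩

include hf hy hker in
lemma quotComplex_shortExact : (quotComplex f y (quotComplex_zero hker)).ShortExact where
  exact := by
    rw [ShortComplex.moduleCat_exact_iff]
    intro v hv
    obtain ⟨w, hw⟩ := (hker v).1 hv
    exact ⟨w, hw.symm⟩
  mono_f := (ModuleCat.mono_iff_injective _).2 hy
  epi_g := (ModuleCat.epi_iff_surjective _).2 hf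

/-- Rees' map `Ext^n_S(N, S) → Ext^{n+1}_R(N, R)`, where `S = R / y`. -/
noncomputable def rees (N : ModuleCat.{u} S) (n : ℕ) (a : Ext.{u} N (of S S) n) :
    Ext.{u} ((restrictScalars f).obj N) (of R R) (n + 1) :=
  (a.mapExactFunctor (restrictScalars f)).comp (quotComplex_shortExact hf hy hker).extClass rfl

lemma rees_add (N : ModuleCat.{u} S) (n : ℕ) (a b : Ext.{u} N (of S S) n) :
    rees hf hy hker N n (a + b) = rees hf hy hker N n a + rees hf hy hker N n b := by
  simp [rees]

lemma rees_zero (N : ModuleCat.{u} S) (n : ℕ) :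
    rees hf hy hker N n 0 = 0 := by
  simp [rees]

lemma rees_comp {N N' : ModuleCat.{u} S} {m n p : ℕ} (h : m + n = p) (c : Ext.{u} N' N m)
    (a : Ext.{u} N (of S S) n) :
    rees hf hy hker N' p (c.comp a h) =
      (c.mapExactFunctor (restrictScalars f)).comp (rees hf hy hker N n a) (by lia) := by
  rw [rees, rees, Ext.mapExactFunctor_comp, Ext.comp_assoc]
  lia

lemma rees_smul (N : ModuleCat.{u} S) (n : ℕ) (r : R) (a : Ext.{u} N (of S S) n) :
    rees hf hy hker N n (f r • a) = r • rees hf hy hker N n a := by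
  rw [← Ext.mk₀_id_comp a, ← Ext.smul_comp, ← Ext.mk₀_smul, rees_comp, rees_comp,
    Ext.mapExactFunctor_mk₀, Ext.mapExactFunctor_mk₀, ← Ext.smul_comp, ← Ext.mk₀_smul]
  rfl

lemma rees_injective_of_ker {N : ModuleCat.{u} S} {n : ℕ}
    (h : ∀ a, rees hf hy hker N n a = 0 → a = 0) : Function.Injective (rees hf hy hker N n) := by
  intro a b hab
  rw [← sub_eq_zero]
  apply h
  have := rees_add hf hy hker N n (a - b) b
  rw [sub_add_cancel, hab] at this
  simpa using this

lemma rees_bijective_zero (N : ModuleCat.{u} S) :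
    Function.Bijective (rees hf hy hker N 0) := by
  have hQ := quotComplex_shortExact hf hy hker
  have hsmul (n : (restrictScalars f).obj N) : y • n = 0 := by
    have : f y = 0 := (hker y).2 dvd_rfl
    change f y • (show N from n) = 0
    rw [this, zero_smul]
  constructor
  · refine rees_injective_of_ker hf hy hker fun a ha ↦ ?_
    obtain ⟨g, rfl⟩ := (Ext.mk₀_bijective _ _).2 a
    rw [rees, Ext.mapExactFunctor_mk₀] at ha
    obtain ⟨x, hx⟩ := Ext.covariant_sequence_exact₃ _ hQ _ _ ha
    obtain ⟨t, rfl⟩ := (Ext.mk₀_bijective _ _).2 x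
    have ht : t = 0 := by
      ext : 1
      refine LinearMap.ext fun n ↦ hy ?_
      refine (t.hom.map_smul y n).symm.trans ?_
      rw [hsmul, map_zero]
      simp
    rw [ht, Ext.mk₀_zero, Ext.zero_comp] at hx
    have : (restrictScalars f).map g = 0 := (Ext.mk₀_eq_zero_iff _).1 hx.symm
    rw [(restrictScalars f).map_eq_zero_iff.1 this, Ext.mk₀_zero]
  · intro a
    have h0 : a.comp (Ext.mk₀ (y • 𝟙 (of R R))) (add_zero _) = 0 := by
      rw [← Ext.smul_eq_comp_mk₀, ← Ext.mk₀_id_comp a, ← Ext.smul_comp, ← Ext.mk₀_smul]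
      have : y • 𝟙 ((restrictScalars f).obj N) = 0 := by
        ext : 1
        exact LinearMap.ext hsmul
      rw [this, Ext.mk₀_zero, Ext.zero_comp]
    obtain ⟨x, rfl⟩ := Ext.covariant_sequence_exact₁ _ hQ a h0 rfl
    obtain ⟨t, rfl⟩ := (Ext.mk₀_bijective _ _).2 x
    let t' : N ⟶ of S S := ModuleCat.ofHom
      { toFun := t.hom
        map_add' := t.hom.map_add
        map_smul' := fun s n ↦ by
          obtain ⟨r, rfl⟩ := hf s
          exact t.hom.map_smul r n }
    refine ⟨Ext.mk₀ t', ?_⟩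
    rw [rees, Ext.mapExactFunctor_mk₀]
    rfl

lemma rees_bijective (n : ℕ) : ∀ (N : ModuleCat.{u} S),
    Function.Bijective (rees hf hy hker N n) := by
  induction n with
  | zero => exact rees_bijective_zero hf hy hker
  | succ n ih =>
    intro N
    have hT := N.shortExact_projectiveShortComplex
    set T := N.projectiveShortComplex
    have hT' := hT.map_of_exact (restrictScalars f)
    have hcl := Ext.mapExactFunctor_extClass (restrictScalars f) hT
    constructor
    · refine rees_injective_of_ker hf hy hker fun a ha ↦ ?_
      obtain ⟨c, rfl⟩ := Ext.contravariant_sequence_exact₃ hT _ a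
        (Ext.eq_zero_of_projective _) (n₀ := n) (by lia)
      rw [rees_comp, hcl] at ha
      obtain ⟨b, hb⟩ := Ext.contravariant_sequence_exact₁ hT' _ _ _ ha
      obtain ⟨c', rfl⟩ := (ih _).2 b
      have : c = (Ext.mk₀ T.f).comp c' (zero_add n) := by
        apply (ih _).1
        rw [rees_comp, Ext.mapExactFunctor_mk₀]
        exact hb.symm
      rw [this]
      simp
    · intro a
      obtain ⟨b, rfl⟩ := Ext.contravariant_sequence_exact₃ hT' _ a
        (ext_free_eq_zero (Module.Free.chooseBasis S T.X₂) hf hy hker _) (n₀ := n + 1) (by lia)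
      obtain ⟨c, rfl⟩ := (ih _).2 b
      refine ⟨hT.extClass.comp c (by lia), ?_⟩
      rw [rees_comp, hcl]
      rfl

end ReesExt

namespace InjHullLimit
variable {R : Type*} [CommRing R]

/-- Baer's criterion for modules over `R ⧸ I₀`, expressed over `R`. -/
def BaerModulo (I₀ : Ideal R) (E : Type*) [AddCommGroup E] [Module R E] : Prop :=
  ∀ (I : Ideal R) (g : I →ₗ[R] E), (∀ a : I, (a : R) ∈ I₀ → g a = 0) →
    ∃ e : E, ∀ a : I, g a = (a : R) • e

/-- `σ` generates the socle of `E` and is contained in every nonzero submodule. -/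
structure IsSocleGenerator [IsLocalRing R] {E : Type*} [AddCommGroup E] [Module R E]
    (σ : E) : Prop where
  ne_zero : σ ≠ 0
  smul_eq_zero : ∀ r ∈ maximalIdeal R, r • σ = 0
  exists_smul_eq : ∀ e : E, e ≠ 0 → ∃ r : R, r • e = σ

section
variable {x : R} (hx : IsSMulRegular R x) {E : Type*} [AddCommGroup E] [Module R E]

include hx in
lemma BaerModulo.exists_pow_smul_eq {a b n : ℕ} (h : a + b = n)
    (hE : BaerModulo (Ideal.span {x ^ n}) E) (e : E) (he : x ^ a • e = 0) :
    ∃ e', x ^ b • e' = e := by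
  have hreg := hx.pow b
  have hdvd (r : Ideal.span {x ^ b}) : ∃ s, x ^ b * s = (r : R) := by
    obtain ⟨s, hs⟩ := Ideal.mem_span_singleton.1 r.2
    exact ⟨s, hs.symm⟩
  choose s hs using hdvd
  let g : Ideal.span {x ^ b} →ₗ[R] E :=
    { toFun r := s r • e
      map_add' r r' := by
        rw [← add_smul]
        congr 1
        apply hreg
        simp only [smul_eq_mul, mul_add, hs, Submodule.coe_add]
      map_smul' c r := by
        rw [RingHom.id_apply, smul_smul]
        congr 1
        apply hreg
        simp only [smul_eq_mul, hs, Submodule.coe_smul]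
        rw [mul_left_comm, hs] }
  obtain ⟨e', he'⟩ := hE _ g fun r hr ↦ by
    obtain ⟨t, ht⟩ := Ideal.mem_span_singleton.1 hr
    have : s r = x ^ a * t := by
      apply hreg
      simp only [smul_eq_mul, hs]
      rw [ht, ← h]
      ring
    simp only [g, LinearMap.coe_mk, AddHom.coe_mk, this]
    rw [mul_comm, mul_smul, he, smul_zero]
  refine ⟨e', ?_⟩
  rw [← he' ⟨x ^ b, Ideal.mem_span_singleton_self _⟩]
  have : s ⟨x ^ b, Ideal.mem_span_singleton_self _⟩ = 1 := by
    apply hreg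
    simp only [smul_eq_mul, hs, mul_one]
  simp only [g, LinearMap.coe_mk, AddHom.coe_mk, this, one_smul]
end

section
variable [IsNoetherianRing R] [IsLocalRing R] {x : R} (hx : IsSMulRegular R x)
  {E : ℕ → Type*} [∀ n, AddCommGroup (E n)] [∀ n, Module R (E n)]
  (hkill : ∀ n (e : E n), x ^ n • e = 0)
  (hbaer : ∀ n, 0 < n → BaerModulo (Ideal.span {x ^ n}) (E n))
  {σ : ∀ n, E n} (hσ : ∀ n, 0 < n → IsSocleGenerator (R := R) (σ n))
  {φ : ∀ {n m : ℕ}, n ≤ m → E n →ₗ[R] E m} {ψ : ∀ {n m : ℕ}, n ≤ m → E m →ₗ[R] E n}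
  (hφψ : ∀ {n m : ℕ} (h : n ≤ m) (e : E m), φ h (ψ h e) = x ^ (m - n) • e)

include hx hkill hbaer hσ hφψ in
lemma transition_injective {n m : ℕ} (hn : 0 < n) (h : n ≤ m) : Function.Injective (φ h) := by
  rw [injective_iff_map_eq_zero]
  intro a ha
  by_contra ha0
  have hσn : φ h (σ n) = 0 := by
    obtain ⟨r, hr⟩ := (hσ n hn).exists_smul_eq a ha0
    rw [← hr, map_smul, ha, smul_zero]
  have hm : 0 < m := hn.trans_le h
  have hpow : x ^ n • σ m = 0 := by
    by_cases hu : x ^ n ∈ maximalIdeal R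
    · exact (hσ m hm).smul_eq_zero _ hu
    · have : IsUnit (x ^ n) := by simpa using hu
      rw [isUnit_pow_iff hn.ne'] at this
      exact absurd (((this.pow m).smul_eq_zero).1 (hkill m (σ m))) (hσ m hm).ne_zero
  obtain ⟨e', he'⟩ := (hbaer m hm).exists_pow_smul_eq hx (b := m - n) (by lia) (σ m) hpow
  have hu0 : ψ h e' ≠ 0 := by
    intro h0
    have := hφψ h e'
    rw [h0, map_zero, he'] at this
    exact (hσ m hm).ne_zero this.symm
  obtain ⟨r, hr⟩ := (hσ n hn).exists_smul_eq _ hu0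
  have h1 : x ^ (m - n) • (r • e') = 0 := by
    rw [← hφψ h, map_smul, hr, hσn]
  obtain ⟨e'', he''⟩ := (hbaer m hm).exists_pow_smul_eq hx (a := m - n) (b := n) (by lia) _ h1
  apply (hσ n hn).ne_zero
  rw [← hr, ← map_smul, ← he'', map_smul, hkill]

variable {H : Type*} [AddCommGroup H] [Module R H] {ι : ∀ n, E n →ₗ[R] H}
  (hιφ : ∀ {n m : ℕ} (h : n ≤ m) (e : E n), ι m (φ h e) = ι n e)
  (hsurj : ∀ a : H, ∃ n e, ι n e = a)
  (hker : ∀ n (e : E n), ι n e = 0 → ∃ (m : ℕ) (h : n ≤ m), φ h e = 0)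

include hx hkill hbaer hσ hφψ hker in
lemma coprojection_injective {n : ℕ} (hn : 0 < n) : Function.Injective (ι n) := by
  rw [injective_iff_map_eq_zero]
  intro a ha
  obtain ⟨m, h, hm⟩ := hker n a ha
  exact (injective_iff_map_eq_zero _).1 (transition_injective hx hkill hbaer hσ hφψ hn h) a hm

include hx hkill hbaer hσ hφψ hker hιφ hsurj in
lemma mem_range_coprojection {n : ℕ} (hn : 0 < n) {a : H} (ha : x ^ n • a = 0) :
    ∃ e, ι n e = a := by
  obtain ⟨m', e₀, rfl⟩ := hsurj a
  set m := max n m'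
  obtain ⟨e, he⟩ : ∃ e, ι m e = ι m' e₀ := ⟨_, hιφ (le_max_right n m') e₀⟩
  have hm : n ≤ m := le_max_left n m'
  rw [← he, ← map_smul] at ha
  have ha' := (injective_iff_map_eq_zero _).1
    (coprojection_injective hx hkill hbaer hσ hφψ hker (hn.trans_le hm)) _ ha
  obtain ⟨e', he'⟩ := (hbaer m (hn.trans_le hm)).exists_pow_smul_eq hx
    (b := m - n) (by lia) e ha'
  refine ⟨ψ hm e', ?_⟩
  rw [← hιφ hm, hφψ, he', he]

include hx hkill hbaer hσ hφψ hker hιφ hsurj in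
lemma limit_baer : Module.Baer R H := by
  intro I g
  have htors (a : H) : ∃ n, x ^ n • a = 0 := by
    obtain ⟨n, e, rfl⟩ := hsurj a
    exact ⟨n, by rw [← map_smul, hkill, map_zero]⟩
  obtain ⟨n, hn⟩ : ∃ n, ∀ a : I, x ^ n • g a = 0 := by
    have hfg : (⊤ : Submodule R I).FG := Module.Finite.fg_top
    obtain ⟨s, hs⟩ := hfg
    choose k hk using htors
    refine ⟨s.sup (fun a ↦ k (g a)), fun a ↦ ?_⟩
    have : (⊤ : Submodule R I) ≤ LinearMap.ker ((x ^ (s.sup fun a ↦ k (g a))) • g) := by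
      rw [← hs, Submodule.span_le]
      intro a ha
      obtain ⟨j, hj⟩ := Nat.exists_eq_add_of_le (Finset.le_sup (f := fun a ↦ k (g a)) ha)
      simp only [SetLike.mem_coe, LinearMap.mem_ker, LinearMap.smul_apply]
      rw [hj, pow_add, mul_comm, mul_smul, hk, smul_zero]
    exact this (Submodule.mem_top (x := a))
  obtain ⟨k, hk⟩ := Ideal.exists_pow_inf_eq_pow_smul (Ideal.span {x}) (I : Submodule R R)
  set N := n + k + 1
  have hN : 0 < N := by lia
  have hvan (a : I) (ha : (a : R) ∈ Ideal.span {x ^ N}) : g a = 0 := by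
    have h1 : (a : R) ∈ (Ideal.span {x}) ^ N • (⊤ : Submodule R R) ⊓ I := by
      refine ⟨?_, a.2⟩
      rw [Ideal.span_singleton_pow]
      simpa using ha
    rw [hk N (by lia), Ideal.span_singleton_pow, Submodule.ideal_span_singleton_smul] at h1
    obtain ⟨b, hb, hba⟩ := (Submodule.mem_smul_pointwise_iff_exists _ _ _).1 h1
    have : a = x ^ (N - k) • (⟨b, hb.2⟩ : I) := Subtype.ext hba.symm
    rw [this, map_smul, show N - k = n + 1 by lia, pow_succ', mul_smul, hn, smul_zero]
  have hinj : Function.Injective (ι N) := coprojection_injective hx hkill hbaer hσ hφψ hker hN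
  have hmem (a : I) : g a ∈ LinearMap.range (ι N) := by
    refine mem_range_coprojection hx hkill hbaer hσ hφψ hιφ hsurj hker hN ?_
    rw [show N = (k + 1) + n by lia, pow_add, mul_smul, hn, smul_zero]
  let g' : I →ₗ[R] E N :=
    (LinearEquiv.ofInjective (ι N) hinj).symm.toLinearMap ∘ₗ g.codRestrict _ hmem
  have hg' (a : I) : ι N (g' a) = g a :=
    congrArg Subtype.val ((LinearEquiv.ofInjective (ι N) hinj).apply_symm_apply ⟨g a, hmem a⟩)
  obtain ⟨e, he⟩ := hbaer N hN I g' fun a ha ↦ hinj (by rw [hg', hvan a ha, map_zero])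
  refine ⟨LinearMap.toSpanSingleton R H (ι N e), fun a ha ↦ ?_⟩
  rw [LinearMap.toSpanSingleton_apply, ← map_smul, ← hg' ⟨a, ha⟩, he ⟨a, ha⟩]

include hx hkill hbaer hσ hφψ hker hιφ hsurj in
lemma exists_socle_embedding : ∃ f : (R ⧸ maximalIdeal R) →ₗ[R] H, Function.Injective f ∧
    ∀ N : Submodule R H, N ≠ ⊥ → N ⊓ LinearMap.range f ≠ ⊥ := by
  have hinj {n : ℕ} (hn : 0 < n) : Function.Injective (ι n) :=
    coprojection_injective hx hkill hbaer hσ hφψ hker hn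
  have h1 := hσ 1 one_pos
  let f : (R ⧸ maximalIdeal R) →ₗ[R] H :=
    (maximalIdeal R).liftQ (LinearMap.toSpanSingleton R H (ι 1 (σ 1))) fun r hr ↦ by
      rw [LinearMap.mem_ker, LinearMap.toSpanSingleton_apply, ← map_smul,
        h1.smul_eq_zero r hr, map_zero]
  have hf (r : R) : f (Submodule.Quotient.mk r) = r • ι 1 (σ 1) := rfl
  have hne : ι 1 (σ 1) ≠ 0 := fun h ↦ h1.ne_zero (hinj one_pos (h.trans (map_zero _).symm))
  refine ⟨f, ?_, fun N hN ↦ ?_⟩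
  · rw [injective_iff_map_eq_zero]
    intro a ha
    obtain ⟨r, rfl⟩ := Submodule.Quotient.mk_surjective _ a
    rw [hf] at ha
    rw [Submodule.Quotient.mk_eq_zero]
    by_contra hr
    have : IsUnit r := by simpa using hr
    exact hne (this.smul_eq_zero.1 ha)
  · obtain ⟨a, haN, ha⟩ := N.ne_bot_iff.1 hN
    obtain ⟨n', e', rfl⟩ := hsurj a
    obtain ⟨e, he⟩ : ∃ e, ι (n' + 1) e = ι n' e' := ⟨_, hιφ (Nat.le_succ n') e'⟩
    rw [← he] at ha haN
    have he0 : e ≠ 0 := by rintro rfl; exact ha (map_zero _)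
    obtain ⟨r, hr⟩ := (hσ _ n'.succ_pos).exists_smul_eq e he0
    have hle : 1 ≤ n' + 1 := by lia
    have hs0 : φ hle (σ 1) ≠ 0 := fun h ↦ hne (by rw [← hιφ hle, h, map_zero])
    obtain ⟨s, hs⟩ := (hσ _ n'.succ_pos).exists_smul_eq _ hs0
    refine (Submodule.ne_bot_iff _).2 ⟨ι _ (σ (n' + 1)), ⟨?_, Submodule.Quotient.mk s, ?_⟩, ?_⟩
    · rw [← hr, map_smul]
      exact N.smul_mem r haN
    · rw [hf, ← hs, map_smul, hιφ]
    · exact fun h ↦ (hσ _ n'.succ_pos).ne_zero (hinj n'.succ_pos (h.trans (map_zero _).symm))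

end
end InjHullLimit

namespace localCohomology
open Limits Opposite
variable {S : Type} [CommRing S] (J : Ideal S) (i : ℕ) (M : ModuleCat.{0} S)

/-- The coprojection `Ext^i(S/J^t, M) → H^i_J(M)`. -/
noncomputable def ofExt (t : ℕ) :
    Abelian.Ext.{0} (ModuleCat.of S (S ⧸ J ^ t)) M i →ₗ[S] LC S J i M :=
  ((colimit.ι (diagram (idealPowersDiagram J) i) (op (op t))).app M).hom ∘ₗ
    (Abelian.Ext.derivedEquiv S _ M i).symm.toLinearMap

/-- The colimit presentation of `H^i_J(M)`. -/
noncomputable def isColimitEvaluation : IsColimit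
    (((evaluation (ModuleCat.{0} S) (ModuleCat.{0} S)).obj M).mapCocone
      (colimit.cocone (diagram (idealPowersDiagram J) i))) :=
  isColimitOfPreserves _ (colimit.isColimit _)

variable {J i M}

lemma ofExt_derivedEquiv (t : ℕ)
    (b : ((Ext S (ModuleCat.{0} S) i).obj (op (ModuleCat.of S (S ⧸ J ^ t)))).obj M) :
    ofExt J i M t (Abelian.Ext.derivedEquiv S _ M i b) =
      (colimit.ι (diagram (idealPowersDiagram J) i) (op (op t))).app M b :=
  congrArg ((colimit.ι (diagram (idealPowersDiagram J) i) (op (op t))).app M).hom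
    ((Abelian.Ext.derivedEquiv S _ M i).symm_apply_apply b)

lemma ofExt_naturality {s t : ℕ} (h : J ^ s ≤ J ^ t) (hts : t ≤ s)
    (a : Abelian.Ext.{0} (ModuleCat.of S (S ⧸ J ^ t)) M i) :
    ofExt J i M s ((Abelian.Ext.mk₀ (ModuleCat.ofHom (Submodule.mapQ _ _ LinearMap.id h) :
      ModuleCat.of S (S ⧸ J ^ s) ⟶ ModuleCat.of S (S ⧸ J ^ t))).comp a (zero_add i)) =
      ofExt J i M t a := by
  obtain ⟨b, rfl⟩ := (Abelian.Ext.derivedEquiv S _ M i).surjective a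
  have := colimit.w (diagram (idealPowersDiagram J) i)
    (show (op (op t) : (ℕᵒᵖ)ᵒᵖ) ⟶ op (op s) from (homOfLE hts).op.op)
  rw [← Abelian.Ext.derivedEquiv_naturality, ofExt_derivedEquiv, ofExt_derivedEquiv, ← this]
  rfl

lemma exists_ofExt_eq (z : LC S J i M) : ∃ t a, ofExt J i M t a = z := by
  obtain ⟨j, y, hy⟩ := Concrete.isColimit_exists_rep _ (isColimitEvaluation J i M) z
  exact ⟨j.unop.unop, Abelian.Ext.derivedEquiv S _ M i y, (ofExt_derivedEquiv _ _).trans hy⟩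

lemma exists_of_ofExt_eq_zero {t : ℕ} (a : Abelian.Ext.{0} (ModuleCat.of S (S ⧸ J ^ t)) M i)
    (ha : ofExt J i M t a = 0) : ∃ s, ∃ hts : t ≤ s,
      (Abelian.Ext.mk₀ (ModuleCat.ofHom (Submodule.mapQ _ _ LinearMap.id
        (Ideal.pow_le_pow_right hts)) :
        ModuleCat.of S (S ⧸ J ^ s) ⟶ ModuleCat.of S (S ⧸ J ^ t))).comp a (zero_add i) = 0 := by
  obtain ⟨b, rfl⟩ := (Abelian.Ext.derivedEquiv S _ M i).surjective a
  obtain ⟨k, f, g, hfg⟩ := Concrete.isColimit_exists_of_rep_eq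
    (diagram (idealPowersDiagram J) i ⋙ (evaluation (ModuleCat.{0} S) (ModuleCat.{0} S)).obj M)
    (isColimitEvaluation J i M) (i := op (op t)) (j := op (op t)) b 0 (by
      rw [ofExt_derivedEquiv] at ha
      rw [map_zero]
      exact ha)
  refine ⟨k.unop.unop, f.unop.unop.down.down, ?_⟩
  rw [← Abelian.Ext.derivedEquiv_naturality]
  rw [map_zero] at hfg
  exact (congrArg _ hfg).trans (map_zero _)

end localCohomology

namespace ExtLimit
open Abelian ModuleCat
variable {R : Type} [CommRing R] (M : ModuleCat.{0} R) (d : ℕ)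

/-- Multiplication by `y` as a map `R ⧸ I → R ⧸ I'`. -/
def quotientMul {I I' : Ideal R} (y : R) (h : ∀ a ∈ I, y * a ∈ I') : (R ⧸ I) →ₗ[R] (R ⧸ I') :=
  Submodule.mapQ I I' (LinearMap.lsmul R R y) h

/-- The map `Ext(R ⧸ I', M) → Ext(R ⧸ I, M)` induced by multiplication by `y`. -/
noncomputable def extMul {I I' : Ideal R} (y : R) (h : ∀ a ∈ I, y * a ∈ I') :
    Ext.{0} (of R (R ⧸ I')) M d →ₗ[R] Ext.{0} (of R (R ⧸ I)) M d where
  toFun a := (Ext.mk₀ (ofHom (quotientMul y h))).comp a (zero_add d)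
  map_add' := by simp
  map_smul' := by simp

variable {M d}

lemma extMul_extMul {I I' I'' : Ideal R} {y z w : R} (h : ∀ a ∈ I, y * a ∈ I')
    (h' : ∀ a ∈ I', z * a ∈ I'') (h'' : ∀ a ∈ I, w * a ∈ I'') (hw : w = z * y)
    (a : Ext.{0} (of R (R ⧸ I'')) M d) :
    extMul M d y h (extMul M d z h' a) = extMul M d w h'' a := by
  subst hw
  simp only [extMul, LinearMap.coe_mk, AddHom.coe_mk]
  rw [← Ext.comp_assoc_of_second_deg_zero, Ext.mk₀_comp_mk₀]
  congr 2
  ext : 1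
  exact Submodule.linearMap_qext _ (LinearMap.ext fun r ↦
    congrArg (Submodule.Quotient.mk (p := I'')) (mul_assoc z y r).symm)

lemma extMul_self {I : Ideal R} (y : R) (h : ∀ a ∈ I, y * a ∈ I)
    (a : Ext.{0} (of R (R ⧸ I)) M d) : extMul M d y h a = y • a := by
  have : ofHom (quotientMul y h) = y • 𝟙 (of R (R ⧸ I)) := by
    ext : 1
    exact Submodule.linearMap_qext _ (LinearMap.ext fun r ↦ rfl)
  simp only [extMul, LinearMap.coe_mk, AddHom.coe_mk, this, Ext.mk₀_smul, Ext.smul_comp,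
    Ext.mk₀_id_comp]

section
variable (M d) {K K' K'' : ℕ → Ideal R} (hK : Antitone K) (hK' : Antitone K') (hK'' : Antitone K'')

include hK in
lemma _root_.Antitone.one_mul_mem {s t : ℕ} (h : s ≤ t) : ∀ a ∈ K t, 1 * a ∈ K s := fun a ha ↦ by
  rw [one_mul]
  exact hK h ha

/-- The direct limit of `Ext(R ⧸ K t, M)`. -/
abbrev ExtColim : Type :=
  Module.DirectLimit (fun t ↦ Ext.{0} (of R (R ⧸ K t)) M d)
    fun _ _ h ↦ extMul M d 1 (hK.one_mul_mem h)

lemma directedSystem : DirectedSystem (fun t ↦ Ext.{0} (of R (R ⧸ K t)) M d)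
    fun _ _ h ↦ extMul M d 1 (hK.one_mul_mem h) where
  map_self t a := by rw [extMul_self, one_smul]
  map_map _ _ _ _ _ a := extMul_extMul _ _ _ (one_mul 1).symm a

/-- The coprojection of the direct limit of `Ext(R ⧸ K t, M)`. -/
noncomputable abbrev coproj (t : ℕ) : Ext.{0} (of R (R ⧸ K t)) M d →ₗ[R] ExtColim M d hK :=
  Module.DirectLimit.of R ℕ (fun t ↦ Ext.{0} (of R (R ⧸ K t)) M d)
    (fun _ _ h ↦ extMul M d 1 (hK.one_mul_mem h)) t

variable {M d}
lemma exists_coproj_eq (z : ExtColim M d hK) : ∃ t a, coproj M d hK t a = z :=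
  Module.DirectLimit.exists_of (G := fun t ↦ Ext.{0} (of R (R ⧸ K t)) M d)
    (f := fun _ _ h ↦ extMul M d 1 (hK.one_mul_mem h)) z

lemma coproj_extMul {s t : ℕ} (h : s ≤ t) (h' : ∀ a ∈ K t, 1 * a ∈ K s)
    (a : Ext.{0} (of R (R ⧸ K s)) M d) :
    coproj M d hK t (extMul M d 1 h' a) = coproj M d hK s a :=
  Module.DirectLimit.of_f (G := fun t ↦ Ext.{0} (of R (R ⧸ K t)) M d)
    (f := fun _ _ h ↦ extMul M d 1 (hK.one_mul_mem h)) (hij := h)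

lemma exists_of_coproj_eq_zero {t : ℕ} {a : Ext.{0} (of R (R ⧸ K t)) M d}
    (h : coproj M d hK t a = 0) : ∃ s, ∃ h : t ≤ s, extMul M d 1 (hK.one_mul_mem h) a = 0 :=
  have := directedSystem M d hK
  Module.DirectLimit.of.zero_exact (G := fun t ↦ Ext.{0} (of R (R ⧸ K t)) M d)
    (f := fun _ _ h ↦ extMul M d 1 (hK.one_mul_mem h)) h

variable (M d) in
/-- The map on direct limits induced by multiplication by `y`. -/
noncomputable def colimMul (y : R) (h : ∀ t, ∀ a ∈ K t, y * a ∈ K' t) :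
    ExtColim M d hK' →ₗ[R] ExtColim M d hK :=
  Module.DirectLimit.map (fun t ↦ extMul M d y (h t)) fun i j hij ↦ by
    have (a) (ha : a ∈ K j) : y * a ∈ K' i := hK' hij (h j a ha)
    ext a
    simp only [LinearMap.comp_apply]
    rw [extMul_extMul _ _ this (one_mul y).symm, extMul_extMul _ _ this (mul_one y).symm]

lemma colimMul_coproj (y : R) (h : ∀ t, ∀ a ∈ K t, y * a ∈ K' t) (t : ℕ)
    (a : Ext.{0} (of R (R ⧸ K' t)) M d) :
    colimMul M d hK hK' y h (coproj M d hK' t a) = coproj M d hK t (extMul M d y (h t) a) :=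
  Module.DirectLimit.map_apply_of _ _ _

lemma colimMul_colimMul {y z w : R} (h : ∀ t, ∀ a ∈ K t, y * a ∈ K' t)
    (h' : ∀ t, ∀ a ∈ K' t, z * a ∈ K'' t) (h'' : ∀ t, ∀ a ∈ K t, w * a ∈ K'' t)
    (hw : w = z * y) (e : ExtColim M d hK'') :
    colimMul M d hK hK' y h (colimMul M d hK' hK'' z h' e) = colimMul M d hK hK'' w h'' e := by
  obtain ⟨t, a, rfl⟩ := exists_coproj_eq hK'' e
  rw [colimMul_coproj, colimMul_coproj, colimMul_coproj, extMul_extMul _ _ (h'' t) hw]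

lemma colimMul_self (y : R) (h : ∀ t, ∀ a ∈ K t, y * a ∈ K t) (e : ExtColim M d hK) :
    colimMul M d hK hK y h e = y • e := by
  obtain ⟨t, a, rfl⟩ := exists_coproj_eq hK e
  rw [colimMul_coproj, extMul_self, map_smul]

lemma smul_eq_zero_of_forall_mem {y : R} (hy : ∀ t, y ∈ K t) (e : ExtColim M d hK) :
    y • e = 0 := by
  obtain ⟨t, a, rfl⟩ := exists_coproj_eq hK e
  rw [← map_smul, ← Ext.mk₀_id_comp (y • a), Ext.comp_smul, ← Ext.smul_comp, ← Ext.mk₀_smul]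
  have : y • 𝟙 (of R (R ⧸ K t)) = 0 := by
    ext : 1
    exact Submodule.linearMap_qext _ (LinearMap.ext fun r ↦
      (Submodule.Quotient.mk_eq_zero _).2 ((K t).mul_mem_right r (hy t)))
  rw [this, Ext.mk₀_zero, Ext.zero_comp, map_zero]

end

section
variable (m : Ideal R) (x : R)

/-- The filtration `m ^ t + (x ^ n)`. -/
def powSup (n t : ℕ) : Ideal R := m ^ t ⊔ Ideal.span {x ^ n}

lemma antitone_pow : Antitone (m ^ · : ℕ → Ideal R) := fun _ _ h ↦ Ideal.pow_le_pow_right h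

lemma antitone_powSup (n : ℕ) : Antitone (powSup m x n) := fun _ _ h ↦
  sup_le_sup_right (Ideal.pow_le_pow_right h) _

lemma powSup_le {n n' : ℕ} (h : n ≤ n') (t : ℕ) : powSup m x n' t ≤ powSup m x n t :=
  sup_le_sup_left (Ideal.span_singleton_le_span_singleton.2 (pow_dvd_pow x h)) _

lemma mul_mem_powSup {n n' : ℕ} (h : n ≤ n') (t : ℕ) :
    ∀ a ∈ powSup m x n t, x ^ (n' - n) * a ∈ powSup m x n' t := by
  intro a ha
  obtain ⟨b, hb, c, hc, rfl⟩ := Submodule.mem_sup.1 ha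
  rw [mul_add]
  refine Submodule.add_mem_sup (Ideal.mul_mem_left _ _ hb) ?_
  obtain ⟨r, rfl⟩ := Ideal.mem_span_singleton.1 hc
  rw [Ideal.mem_span_singleton, ← mul_assoc, ← pow_add, Nat.sub_add_cancel h]
  exact dvd_mul_right _ _

variable {m x}
lemma powSup_le_pow (hx : x ∈ m) {n t : ℕ} (h : t ≤ n) : powSup m x n t ≤ m ^ t :=
  sup_le le_rfl ((Ideal.span_singleton_le_iff_mem _).2
    (Ideal.pow_le_pow_right h (Ideal.pow_mem_pow hx n)))

end

end ExtLimit

namespace ExtLimit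
open Abelian ModuleCat ReesExt

section
variable {R S : Type} [CommRing R] [CommRing S] {f : R →+* S} (hf : Function.Surjective f)

/-- If `I` is the preimage of `L`, then `R ⧸ I` is isomorphic to `S ⧸ L`. -/
noncomputable def quotientIso {I : Ideal R} {L : Ideal S} (hI : ∀ r, r ∈ I ↔ f r ∈ L) :
    of R (R ⧸ I) ≅ (restrictScalars f).obj (of S (S ⧸ L)) :=
  LinearEquiv.toModuleIso <| LinearEquiv.ofBijective
    (I.liftQ (({ toFun := fun r ↦ (Submodule.Quotient.mk (f r) : S ⧸ L)
                 map_add' := fun r s ↦ by rw [map_add]; rfl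
                 map_smul' := fun r s ↦ by rw [smul_eq_mul, map_mul]; rfl } :
          R →ₗ[R] (restrictScalars f).obj (of S (S ⧸ L))))
      fun r hr ↦ (Submodule.Quotient.mk_eq_zero L).2 ((hI r).1 hr)) <| by
    constructor
    · rw [injective_iff_map_eq_zero]
      intro a ha
      obtain ⟨r, rfl⟩ := Submodule.Quotient.mk_surjective _ a
      exact (Submodule.Quotient.mk_eq_zero I).2
        ((hI r).2 ((Submodule.Quotient.mk_eq_zero L).1 ha))
    · intro a
      obtain ⟨s, hs⟩ := Submodule.Quotient.mk_surjective L a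
      obtain ⟨r, rfl⟩ := hf s
      exact ⟨Submodule.Quotient.mk r, hs⟩

lemma quotientIso_hom_naturality {I I' : Ideal R} {L L' : Ideal S} (hI : ∀ r, r ∈ I ↔ f r ∈ L)
    (hI' : ∀ r, r ∈ I' ↔ f r ∈ L') (h : ∀ a ∈ I, 1 * a ∈ I') (h' : L ≤ L') :
    ofHom (quotientMul 1 h) ≫ (quotientIso hf hI').hom = (quotientIso hf hI).hom ≫
      (restrictScalars f).map (ofHom (Submodule.mapQ L L' LinearMap.id h')) := by
  ext : 1
  refine Submodule.linearMap_qext _ (LinearMap.ext fun r ↦ ?_)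
  change (Submodule.Quotient.mk (f (1 * r)) : S ⧸ L') = Submodule.Quotient.mk (f r)
  rw [one_mul]

variable {y : R} (hy : IsSMulRegular R y) (hker : ∀ r, f r = 0 ↔ y ∣ r) (d : ℕ)

/-- Rees' isomorphism for `Ext_S(S ⧸ L, S)`. -/
noncomputable def reesQuotient {I : Ideal R} {L : Ideal S} (hI : ∀ r, r ∈ I ↔ f r ∈ L)
    (b : Ext.{0} (of S (S ⧸ L)) (of S S) d) : Ext.{0} (of R (R ⧸ I)) (of R R) (d + 1) :=
  (Ext.mk₀ (quotientIso hf hI).hom).comp (rees hf hy hker _ d b) (zero_add _)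

lemma reesQuotient_bijective {I : Ideal R} {L : Ideal S} (hI : ∀ r, r ∈ I ↔ f r ∈ L) :
    Function.Bijective (reesQuotient hf hy hker d hI) := by
  refine Function.Bijective.comp (g := fun a ↦ (Ext.mk₀ (quotientIso hf hI).hom).comp a
    (zero_add _)) ⟨fun a b hab ↦ ?_, fun a ↦ ?_⟩ (rees_bijective hf hy hker d _)
  · have := congrArg (fun a ↦ (Ext.mk₀ (quotientIso hf hI).inv).comp a (zero_add _)) hab
    simpa [← Ext.comp_assoc_of_second_deg_zero] using this
  · refine ⟨(Ext.mk₀ (quotientIso hf hI).inv).comp a (zero_add _), ?_⟩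
    simp [← Ext.comp_assoc_of_second_deg_zero]

lemma reesQuotient_add {I : Ideal R} {L : Ideal S} (hI : ∀ r, r ∈ I ↔ f r ∈ L)
    (a b : Ext.{0} (of S (S ⧸ L)) (of S S) d) : reesQuotient hf hy hker d hI (a + b) =
      reesQuotient hf hy hker d hI a + reesQuotient hf hy hker d hI b := by
  simp [reesQuotient, rees_add]

lemma reesQuotient_zero {I : Ideal R} {L : Ideal S} (hI : ∀ r, r ∈ I ↔ f r ∈ L) :
    reesQuotient hf hy hker d hI 0 = 0 := by
  simp [reesQuotient, rees_zero]

lemma reesQuotient_smul {I : Ideal R} {L : Ideal S} (hI : ∀ r, r ∈ I ↔ f r ∈ L) (r : R)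
    (a : Ext.{0} (of S (S ⧸ L)) (of S S) d) :
    reesQuotient hf hy hker d hI (f r • a) = r • reesQuotient hf hy hker d hI a := by
  rw [reesQuotient, rees_smul, Ext.comp_smul, reesQuotient]

lemma reesQuotient_naturality {I I' : Ideal R} {L L' : Ideal S} (hI : ∀ r, r ∈ I ↔ f r ∈ L)
    (hI' : ∀ r, r ∈ I' ↔ f r ∈ L') (h : ∀ a ∈ I, 1 * a ∈ I') (h' : L ≤ L')
    (b : Ext.{0} (of S (S ⧸ L')) (of S S) d) :
    extMul (of R R) (d + 1) 1 h (reesQuotient hf hy hker d hI' b) =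
      reesQuotient hf hy hker d hI ((Ext.mk₀ (ofHom (Submodule.mapQ L L' LinearMap.id h') :
        of S (S ⧸ L) ⟶ of S (S ⧸ L'))).comp b (zero_add d)) := by
  simp only [reesQuotient, extMul, LinearMap.coe_mk, AddHom.coe_mk]
  rw [rees_comp, Ext.mapExactFunctor_mk₀, ← Ext.comp_assoc_of_second_deg_zero,
    ← Ext.comp_assoc_of_second_deg_zero, Ext.mk₀_comp_mk₀, Ext.mk₀_comp_mk₀,
    quotientIso_hom_naturality]

variable {K : ℕ → Ideal R} (hK : Antitone K) {J : Ideal S} (hKJ : ∀ t r, r ∈ K t ↔ f r ∈ J ^ t)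

/-- The map from `Ext_R(R ⧸ K t, R)` to the local cohomology of `S`. -/
noncomputable def toLocalCohomology (t : ℕ) : Ext.{0} (of R (R ⧸ K t)) (of R R) (d + 1) →ₗ[R]
    (restrictScalars f).obj (LC S J d (of S S)) where
  toFun a := localCohomology.ofExt J d (of S S) t
    ((Equiv.ofBijective _ (reesQuotient_bijective hf hy hker d (hKJ t))).symm a)
  map_add' a b := by
    obtain ⟨a, rfl⟩ := (reesQuotient_bijective hf hy hker d (hKJ t)).2 a
    obtain ⟨b, rfl⟩ := (reesQuotient_bijective hf hy hker d (hKJ t)).2 b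
    rw [← reesQuotient_add]
    simp only [Equiv.ofBijective_symm_apply_apply]
    exact map_add _ _ _
  map_smul' r a := by
    obtain ⟨a, rfl⟩ := (reesQuotient_bijective hf hy hker d (hKJ t)).2 a
    rw [← reesQuotient_smul]
    simp only [Equiv.ofBijective_symm_apply_apply]
    exact map_smul _ (f r) _

lemma toLocalCohomology_reesQuotient (t : ℕ) (b : Ext.{0} (of S (S ⧸ J ^ t)) (of S S) d) :
    toLocalCohomology hf hy hker d hKJ t (reesQuotient hf hy hker d (hKJ t) b) =
      localCohomology.ofExt J d (of S S) t b :=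
  congrArg (localCohomology.ofExt J d (of S S) t) (Equiv.ofBijective_symm_apply_apply ..)

/-- The map from the direct limit of `Ext_R(R ⧸ K t, R)` to the local cohomology of `S`. -/
noncomputable def colimToLocalCohomology : ExtColim (of R R) (d + 1) hK →ₗ[R]
    (restrictScalars f).obj (LC S J d (of S S)) :=
  Module.DirectLimit.lift R ℕ (fun t ↦ Ext.{0} (of R (R ⧸ K t)) (of R R) (d + 1))
    (fun _ _ h ↦ extMul (of R R) (d + 1) 1 (hK.one_mul_mem h))
    (toLocalCohomology hf hy hker d hKJ) fun s t h a ↦ by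
      obtain ⟨a, rfl⟩ := (reesQuotient_bijective hf hy hker d (hKJ s)).2 a
      rw [reesQuotient_naturality hf hy hker d (hKJ t) _ _ (Ideal.pow_le_pow_right h),
        toLocalCohomology_reesQuotient, toLocalCohomology_reesQuotient]
      exact localCohomology.ofExt_naturality _ h a

lemma colimToLocalCohomology_coproj (t : ℕ) (b : Ext.{0} (of S (S ⧸ J ^ t)) (of S S) d) :
    colimToLocalCohomology hf hy hker d hK hKJ (coproj (of R R) (d + 1) hK t
      (reesQuotient hf hy hker d (hKJ t) b)) = localCohomology.ofExt J d (of S S) t b :=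
  (Module.DirectLimit.lift_of ..).trans (toLocalCohomology_reesQuotient ..)

lemma colimToLocalCohomology_bijective :
    Function.Bijective (colimToLocalCohomology hf hy hker d hK hKJ) := by
  constructor
  · rw [injective_iff_map_eq_zero]
    intro z hz
    obtain ⟨t, a, rfl⟩ := exists_coproj_eq hK z
    obtain ⟨b, rfl⟩ := (reesQuotient_bijective hf hy hker d (hKJ t)).2 a
    rw [colimToLocalCohomology_coproj] at hz
    obtain ⟨s, hs, h⟩ := localCohomology.exists_of_ofExt_eq_zero b hz
    rw [← coproj_extMul hK hs (hK.one_mul_mem hs),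
      reesQuotient_naturality hf hy hker d (hKJ s) _ _ (Ideal.pow_le_pow_right hs), h,
      reesQuotient_zero, map_zero]
  · intro z
    obtain ⟨t, b, rfl⟩ := localCohomology.exists_ofExt_eq (M := of S S) z
    exact ⟨_, colimToLocalCohomology_coproj hf hy hker d hK hKJ t b⟩

end

section
variable {R : Type} [CommRing R] (J : Ideal R) (d : ℕ)

lemma extMul_one {M : ModuleCat.{0} R} {I I' : Ideal R} (h : ∀ a ∈ I, 1 * a ∈ I') (h' : I ≤ I')
    (a : Ext.{0} (of R (R ⧸ I')) M d) :
    extMul M d 1 h a = (Ext.mk₀ (ofHom (Submodule.mapQ I I' LinearMap.id h') :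
      of R (R ⧸ I) ⟶ of R (R ⧸ I'))).comp a (zero_add d) := by
  have : quotientMul 1 h = Submodule.mapQ I I' LinearMap.id h' :=
    Submodule.linearMap_qext _ (LinearMap.ext fun r ↦
      congrArg (Submodule.Quotient.mk (p := I')) (one_mul r))
  rw [← this]
  rfl

lemma ofExt_extMul {M : ModuleCat.{0} R} {s t : ℕ} (h : s ≤ t) (h' : ∀ a ∈ J ^ t, 1 * a ∈ J ^ s)
    (a : Ext.{0} (of R (R ⧸ J ^ s)) M d) :
    localCohomology.ofExt J d M t (extMul M d 1 h' a) = localCohomology.ofExt J d M s a := by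
  rw [extMul_one _ _ (Ideal.pow_le_pow_right h)]
  exact localCohomology.ofExt_naturality (Ideal.pow_le_pow_right h) h a

/-- Local cohomology as a direct limit of `Ext(R ⧸ J ^ t, M)`. -/
noncomputable def colimEquivLocalCohomology (M : ModuleCat.{0} R) :
    ExtColim M d (antitone_pow J) ≃ₗ[R] LC R J d M :=
  LinearEquiv.ofBijective
    (Module.DirectLimit.lift R ℕ (fun t ↦ Ext.{0} (of R (R ⧸ J ^ t)) M d)
      (fun _ _ h ↦ extMul M d 1 ((antitone_pow J).one_mul_mem h))
      (localCohomology.ofExt J d M) fun s t h a ↦ ofExt_extMul J d h _ a) <| by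
    constructor
    · rw [injective_iff_map_eq_zero]
      intro z hz
      obtain ⟨t, a, rfl⟩ := exists_coproj_eq (antitone_pow J) z
      rw [Module.DirectLimit.lift_of] at hz
      obtain ⟨s, hs, h⟩ := localCohomology.exists_of_ofExt_eq_zero a hz
      rw [← coproj_extMul _ hs ((antitone_pow J).one_mul_mem hs)]
      rw [extMul_one _ _ (Ideal.pow_le_pow_right hs), h, map_zero]
    · intro z
      obtain ⟨t, b, rfl⟩ := localCohomology.exists_ofExt_eq z
      exact ⟨coproj M d (antitone_pow J) t b, Module.DirectLimit.lift_of ..⟩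

end

end ExtLimit

namespace IsInjHull
open InjHullLimit
variable {R S E : Type} [CommRing R] [CommRing S] {f : R →+* S}
  (hf : Function.Surjective f) [AddCommGroup E] [Module S E] {J : Ideal S} (hE : IsInjHull S J E)
  {E' : Type} [AddCommGroup E'] [Module R E'] {β : E' → E} (hβ : Function.Bijective β)
  (hadd : ∀ a b, β (a + b) = β a + β b) (hsmul : ∀ (r : R) a, β (r • a) = f r • β a)

include hf hE hβ hadd hsmul in
lemma baerModulo {I₀ : Ideal R} (hker : ∀ r, f r = 0 → r ∈ I₀) : BaerModulo I₀ E' := by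
  intro I g hg
  have hex (s : I.map f) : ∃ a : I, f a = s := by
    obtain ⟨a, ha, h⟩ := (Ideal.mem_map_iff_of_surjective f hf).1 s.2
    exact ⟨⟨a, ha⟩, h⟩
  choose c hc using hex
  have hg' (a b : I) (h : f a = f b) : g a = g b := by
    rw [← sub_eq_zero, ← map_sub]
    exact hg _ (hker _ (by simp [h]))
  let g' : I.map f →ₗ[S] E :=
    { toFun s := β (g (c s))
      map_add' s t := by
        rw [← hadd, ← map_add]
        congr 1
        exact hg' _ _ (by simp [hc])
      map_smul' s t := by
        obtain ⟨r, rfl⟩ := hf s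
        rw [RingHom.id_apply, ← hsmul, ← map_smul]
        congr 1
        exact hg' _ _ (by simp [hc]) }
  obtain ⟨h, hh⟩ := Module.Baer.of_injective hE.1 _ g'
  obtain ⟨e, he⟩ := hβ.2 (h 1)
  refine ⟨e, fun a ↦ hβ.1 ?_⟩
  have := hh (f a) (Ideal.mem_map_of_mem f a.2)
  rw [hsmul, he, ← map_smul, smul_eq_mul, mul_one, this]
  exact congrArg β (hg' _ _ (hc ⟨f a, Ideal.mem_map_of_mem f a.2⟩).symm)

include hf hE hβ hsmul in
lemma exists_isSocleGenerator [IsLocalRing R] [Nontrivial S] (hJ : J = (maximalIdeal R).map f) :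
    ∃ σ : E', IsSocleGenerator (R := R) σ := by
  obtain ⟨F, hF, hess⟩ := hE.2
  obtain ⟨σ, hσ⟩ := hβ.2 (F (Submodule.Quotient.mk 1))
  have hβ0 : β 0 = 0 := by simpa using hsmul 0 0
  have hmem (r : R) : f r ∈ J ↔ r ∈ maximalIdeal R := by
    refine ⟨fun h ↦ ?_, fun h ↦ hJ ▸ Ideal.mem_map_of_mem f h⟩
    rw [hJ] at h
    obtain ⟨a, ha, h⟩ := (Ideal.mem_map_iff_of_surjective f hf).1 h
    by_contra hr
    have : IsUnit (r - a) := by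
      by_contra hra
      exact hr (by simpa using Ideal.add_mem _ ((mem_maximalIdeal _).2 hra) ha)
    have := this.map f
    rw [map_sub, h, sub_self] at this
    exact not_isUnit_zero this
  have hF' (r : R) : F (Submodule.Quotient.mk (f r)) = β (r • σ) := by
    rw [hsmul, hσ, ← map_smul, ← Submodule.Quotient.mk_smul, smul_eq_mul, mul_one]
  have hF0 (r : R) : r • σ = 0 ↔ r ∈ maximalIdeal R := by
    rw [← hmem, ← Submodule.Quotient.mk_eq_zero, ← map_eq_zero_iff F hF, hF']
    exact ⟨fun h ↦ by rw [h, hβ0], fun h ↦ hβ.1 (h.trans hβ0.symm)⟩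
  refine ⟨σ, fun h ↦ ?_, fun r hr ↦ (hF0 r).2 hr, fun e he ↦ ?_⟩
  · have : (1 : R) ∈ maximalIdeal R := (hF0 1).1 (by rw [h, smul_zero])
    exact (Ideal.ne_top_iff_one _).1 (maximalIdeal.isMaximal R).ne_top this
  · have hN : Submodule.span S {β e} ≠ ⊥ := by
      rw [Ne, Submodule.span_singleton_eq_bot]
      exact fun h ↦ he (hβ.1 (h.trans hβ0.symm))
    obtain ⟨z, ⟨hz, u, rfl⟩, hz0⟩ := (Submodule.ne_bot_iff _).1 (hess _ hN)
    obtain ⟨s, hs⟩ := Submodule.mem_span_singleton.1 hz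
    obtain ⟨a, rfl⟩ := hf s
    obtain ⟨v, rfl⟩ := Submodule.Quotient.mk_surjective _ u
    obtain ⟨b, rfl⟩ := hf v
    rw [← hsmul, hF'] at hs
    have hb : IsUnit b := by
      by_contra hb
      exact hz0 (by rw [hF', (hF0 b).2 ((mem_maximalIdeal _).2 hb), hβ0])
    obtain ⟨w, rfl⟩ := hb
    refine ⟨↑w⁻¹ * a, ?_⟩
    rw [mul_smul, hβ.1 hs, smul_smul, Units.inv_mul, one_smul]

end IsInjHull

namespace ExtLimit
open InjHullLimit ModuleCat
variable {R : Type} [CommRing R]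

lemma quotientMk_mem_map_pow_iff (I : Ideal R) (x : R) (n t : ℕ) (r : R) :
    r ∈ powSup I x n t ↔
      Ideal.Quotient.mk (Ideal.span {x ^ n}) r ∈
        (I.map (Ideal.Quotient.mk (Ideal.span {x ^ n}))) ^ t := by
  rw [← Ideal.map_pow, ← Ideal.mem_comap,
    Ideal.comap_map_of_surjective _ Ideal.Quotient.mk_surjective]
  rw [show Ideal.comap (Ideal.Quotient.mk (Ideal.span {x ^ n})) ⊥ = Ideal.span {x ^ n} from
    Ideal.mk_ker]
  rfl

lemma baerModulo_and_exists_isSocleGenerator [IsLocalRing R] {x : R}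
    (hreg : IsSMulRegular R x) {n d : ℕ}
    [Nontrivial (R ⧸ Ideal.span {x ^ n})] {E : ModuleCat (R ⧸ Ideal.span {x ^ n})}
    (hE : IsInjHull (R ⧸ Ideal.span {x ^ n})
      ((maximalIdeal R).map (Ideal.Quotient.mk (Ideal.span {x ^ n}))) E)
    (e : LC (R ⧸ Ideal.span {x ^ n}) ((maximalIdeal R).map
      (Ideal.Quotient.mk (Ideal.span {x ^ n}))) d (ModuleCat.of _ (R ⧸ Ideal.span {x ^ n}))
        ≃ₗ[R ⧸ Ideal.span {x ^ n}] E) :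
    BaerModulo (Ideal.span {x ^ n})
      (ExtColim (of R R) (d + 1) (antitone_powSup (maximalIdeal R) x n)) ∧
    ∃ σ : ExtColim (of R R) (d + 1) (antitone_powSup (maximalIdeal R) x n),
      IsSocleGenerator (R := R) σ := by
  let f := Ideal.Quotient.mk (Ideal.span {x ^ n})
  have hf : Function.Surjective f := Ideal.Quotient.mk_surjective
  have hker (r : R) : f r = 0 ↔ x ^ n ∣ r := by
    rw [Ideal.Quotient.eq_zero_iff_mem, Ideal.mem_span_singleton]
  let γ := colimToLocalCohomology hf (hreg.pow n) hker d
    (antitone_powSup (maximalIdeal R) x n) (quotientMk_mem_map_pow_iff (maximalIdeal R) x n)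
  have hγ : Function.Bijective γ := colimToLocalCohomology_bijective ..
  have hβ : Function.Bijective fun z ↦ e (γ z) := e.bijective.comp hγ
  have hsmul (r : R) (a) : e (γ (r • a)) = f r • e (γ a) := by
    rw [map_smul γ]
    exact map_smul e (f r) (γ a)
  refine ⟨hE.baerModulo hf hβ (fun a b ↦ ?_) hsmul fun r ↦ Ideal.Quotient.eq_zero_iff_mem.1,
    hE.exists_isSocleGenerator hf hβ hsmul rfl⟩
  rw [map_add γ]
  exact map_add e _ _

variable [IsNoetherianRing R] [IsLocalRing R] {x : R}

lemma isInjHull_extColim {d : ℕ} (hreg : IsSMulRegular R x) (hx : x ∈ maximalIdeal R)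
    (hE : ∀ n, 0 < n → BaerModulo (Ideal.span {x ^ n})
      (ExtColim (of R R) d (antitone_powSup (maximalIdeal R) x n)) ∧
        ∃ σ : ExtColim (of R R) d (antitone_powSup (maximalIdeal R) x n),
          IsSocleGenerator (R := R) σ) :
    IsInjHull R (maximalIdeal R) (ExtColim (of R R) d (antitone_pow (maximalIdeal R))) := by
  let m := maximalIdeal R
  have hσ (n : ℕ) : ∃ σ : ExtColim (of R R) d (antitone_powSup m x n),
      0 < n → IsSocleGenerator (R := R) σ := by
    rcases n.eq_zero_or_pos with rfl | hn
    · exact ⟨0, fun h ↦ absurd h (lt_irrefl 0)⟩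
    · exact (hE n hn).2.imp fun _ h _ ↦ h
  choose σ hσ using hσ
  have hone {I I' : Ideal R} (h : I ≤ I') : ∀ a ∈ I, 1 * a ∈ I' := fun a ha ↦ by
    rw [one_mul]
    exact h ha
  have hkill (n : ℕ) (e : ExtColim (of R R) d (antitone_powSup m x n)) : x ^ n • e = 0 :=
    smul_eq_zero_of_forall_mem _ (fun t ↦ Ideal.mem_sup_right (Ideal.mem_span_singleton_self _)) e
  let φ {n n' : ℕ} (hn : n ≤ n') := colimMul (of R R) d (antitone_powSup m x n')
    (antitone_powSup m x n) 1 fun t ↦ hone (powSup_le m x hn t)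
  let ψ {n n' : ℕ} (hn : n ≤ n') := colimMul (of R R) d (antitone_powSup m x n)
    (antitone_powSup m x n') (x ^ (n' - n)) (mul_mem_powSup m x hn)
  let ι (n : ℕ) := colimMul (of R R) d (antitone_pow m) (antitone_powSup m x n) 1
    fun t ↦ hone le_sup_left
  have hφψ {n n' : ℕ} (hn : n ≤ n') (e) : φ hn (ψ hn e) = x ^ (n' - n) • e := by
    rw [← colimMul_self _ _ fun t a ha ↦ Ideal.mul_mem_left _ _ ha]
    exact colimMul_colimMul _ _ _ _ _ _ (mul_one _).symm e
  have hιφ {n n' : ℕ} (hn : n ≤ n') (e) : ι n' (φ hn e) = ι n e :=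
    colimMul_colimMul _ _ _ _ _ _ (one_mul 1).symm e
  have hsurj (a) : ∃ n e, ι n e = a := by
    obtain ⟨t, a, rfl⟩ := exists_coproj_eq _ a
    refine ⟨t, coproj _ _ _ t (extMul _ _ 1 (hone (powSup_le_pow hx le_rfl)) a), ?_⟩
    simp only [ι]
    rw [colimMul_coproj, extMul_extMul _ _ (hone le_rfl) (one_mul 1).symm, extMul_self, one_smul]
  have hker (n : ℕ) (e) (he : ι n e = 0) : ∃ n', ∃ hn : n ≤ n', φ hn e = 0 := by
    obtain ⟨t, a, rfl⟩ := exists_coproj_eq _ e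
    simp only [ι] at he
    rw [colimMul_coproj] at he
    obtain ⟨s, hs, h0⟩ := exists_of_coproj_eq_zero _ he
    refine ⟨max n s, le_max_left _ _, ?_⟩
    have hle : powSup m x (max n s) s ≤ powSup m x n t :=
      (powSup_le m x (le_max_left n s) s).trans (antitone_powSup m x n hs)
    have hle' : m ^ s ≤ powSup m x n t := (Ideal.pow_le_pow_right hs).trans le_sup_left
    rw [extMul_extMul _ _ (hone hle') (one_mul 1).symm] at h0
    have h1 := congrArg (extMul (of R R) d 1
      (hone (powSup_le_pow hx (le_max_right n s)))) h0
    rw [extMul_extMul _ _ (hone hle) (one_mul 1).symm, map_zero] at h1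
    simp only [φ]
    rw [colimMul_coproj, ← coproj_extMul _ hs
      (hone (antitone_powSup m x _ hs)), extMul_extMul _ _ (hone hle) (one_mul 1).symm, h1,
      map_zero]
  exact ⟨(limit_baer hreg hkill (fun n hn ↦ (hE n hn).1) hσ hφψ hιφ hsurj hker).injective,
    exists_socle_embedding hreg hkill (fun n hn ↦ (hE n hn).1) hσ hφψ hιφ hsurj hker⟩

/-- A local ring is quasi-Gorenstein if all its quotients by powers of a regular element are. -/
lemma isQuasiGorensteinAt_of_quotient (hreg : IsSMulRegular R x)
    (h : ∀ n : ℕ, 0 < n → IsQuasiGorensteinAt (R ⧸ Ideal.span {x ^ n})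
      ((maximalIdeal R).map (Ideal.Quotient.mk (Ideal.span {x ^ n})))) :
    IsQuasiGorensteinAt R (maximalIdeal R) := by
  have hnt (n : ℕ) (hn : 0 < n) : Nontrivial (R ⧸ Ideal.span {x ^ n}) := by
    obtain ⟨d, hd, -⟩ := h n hn
    by_contra hS
    rw [not_nontrivial_iff_subsingleton] at hS
    simp [ringKrullDim_eq_bot_of_subsingleton] at hd
  have hx : x ∈ maximalIdeal R := by
    rw [mem_maximalIdeal]
    intro hx
    have := hnt 1 one_pos
    exact Ideal.Quotient.nontrivial_iff.1 this (Ideal.eq_top_of_isUnit_mem _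
      (Ideal.mem_span_singleton_self _) (by simpa using hx))
  have hdim (n : ℕ) (hn : 0 < n) : ringKrullDim (R ⧸ Ideal.span {x ^ n}) + 1 = ringKrullDim R :=
    ringKrullDim_quotient_span_singleton_succ_eq_ringKrullDim_of_mem_jacobson (hreg.pow n)
      (by rw [ringJacobson_eq_maximalIdeal]; exact Ideal.pow_mem_of_mem _ hx n hn)
  obtain ⟨d, hd, -⟩ := h 1 one_pos
  have hdR : ringKrullDim R = (d + 1 : ℕ) := by
    rw [← hdim 1 one_pos, hd]
    rfl
  refine ⟨d + 1, hdR, of R (ExtColim (of R R) (d + 1) (antitone_pow (maximalIdeal R))),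
    isInjHull_extColim hreg hx fun n hn ↦ ?_,
    ⟨(colimEquivLocalCohomology _ _ _).symm⟩⟩
  obtain ⟨d', hd', E, hE, ⟨e⟩⟩ := h n hn
  obtain rfl : d' = d := by
    have h1 := hdim n hn
    rw [hd', hdR] at h1
    have h2 : d' + 1 = d + 1 := by exact_mod_cast h1
    lia
  have := hnt n hn
  exact baerModulo_and_exists_isSocleGenerator hreg hE e

end ExtLimit

theorem stmt9 (R : Type) [CommRing R] [IsNoetherianRing R] [IsLocalRing R]
    (x : R) (hreg : IsSMulRegular R x)
    (h : ∀ n : ℕ, 0 < n →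
      IsQuasiGorensteinAt (R ⧸ Ideal.span {x ^ n})
        ((maximalIdeal R).map (Ideal.Quotient.mk (Ideal.span {x ^ n})))) :
    IsQuasiGorensteinAt R (maximalIdeal R) :=
  ExtLimit.isQuasiGorensteinAt_of_quotient hreg h
end

section
/- Let (R, m) be a Noetherian local ring with depth(R) = 0, and let M be a totally reflexive R-module that is indecomposable and faithful (0 :_R M = 0). Then M ≅ R. Consequently, if M is totally reflexive and Hom_R(M, M) ≅ R, then M ≅ R. -/
open CategoryTheory IsLocalRing Pointwise

/-- Over a Noetherian local ring of depth zero, the maximal ideal kills a nonzero element. -/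
theorem exists_ne_zero_forall_mul_eq_zero_of_gradeI_eq_zero (R : Type) [CommRing R]
    [IsNoetherianRing R] [IsLocalRing R] (hdepth : gradeI R (maximalIdeal R) R = 0) :
    ∃ s : R, s ≠ 0 ∧ ∀ a ∈ maximalIdeal R, a * s = 0 := by
  have hreg : ∀ r ∈ maximalIdeal R, ¬ IsSMulRegular R r := by
    intro r hr hrr
    have h := ENat.sSup_eq_zero.1 hdepth 1 ⟨[r], by simp, by simpa using hr,
      (RingTheory.Sequence.isWeaklyRegular_singleton_iff R r).2 hrr, fun htop ↦ ?_⟩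
    · exact one_ne_zero h
    · rw [Ideal.ofList_singleton, smul_eq_mul, Ideal.mul_top] at htop
      exact (maximalIdeal.isMaximal R).ne_top <|
        top_le_iff.1 <| htop.trans_le <| (Ideal.span_singleton_le_iff_mem _).2 hr
  have hsub : (maximalIdeal R : Set R) ⊆ ⋃ p ∈ associatedPrimes R R, (id p : Ideal R) := by
    intro r hr
    simpa using (biUnion_associatedPrimes_eq_compl_regular R R).symm.subset (hreg r hr)
  obtain ⟨p, hp, hle⟩ := (Ideal.subset_union_prime_finite (associatedPrimes.finite R R) ⊥ ⊥
    fun p hp _ _ ↦ hp.isPrime).1 hsub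
  obtain ⟨hprime, s, hs⟩ := isAssociatedPrime_iff.1 hp
  refine ⟨s, ?_, fun a ha ↦ ?_⟩
  · rintro rfl
    exact hprime.ne_top (by simp [hs])
  · have h := hle ha
    rw [hs] at h
    simpa [Submodule.mem_colon_singleton] using h

/-- Over a local ring whose maximal ideal kills a nonzero element, a faithful reflexive module
has a linear functional taking the value `1`. -/
theorem Module.IsReflexive.exists_dual_apply_eq_one {R M : Type*} [CommRing R] [IsLocalRing R]
    [AddCommGroup M] [Module R M] [Module.IsReflexive R M]
    (hsoc : ∃ s : R, s ≠ 0 ∧ ∀ a ∈ maximalIdeal R, a * s = 0)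
    (hM : Module.annihilator R M = ⊥) : ∃ (f : Module.Dual R M) (x : M), f x = 1 := by
  obtain ⟨s, hs0, hs⟩ := hsoc
  obtain ⟨x, hx⟩ : ∃ x : M, s • x ≠ 0 := by
    by_contra! h
    have : s ∈ Module.annihilator R M := Module.mem_annihilator.2 h
    exact hs0 (by simpa [hM] using this)
  obtain ⟨f, hf⟩ : ∃ f : Module.Dual R M, f (s • x) ≠ 0 := by
    by_contra! h
    exact hx ((Module.bijective_dual_eval R M).1 (by ext f; simpa using h f))
  have hu : IsUnit (f x) := by
    by_contra hnu
    exact hf (by rw [map_smul, smul_eq_mul, mul_comm, hs _ ((mem_maximalIdeal _).2 hnu)])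
  obtain ⟨u, hu⟩ := hu
  exact ⟨((u⁻¹ : Rˣ) : R) • f, x, by simp [← hu]⟩

/-- A functional taking the value `1` splits off the submodule spanned by a preimage of `1`. -/
theorem Module.Dual.isCompl_ker_span_singleton {R M : Type*} [CommRing R] [AddCommGroup M]
    [Module R M] {f : Module.Dual R M} {x : M} (hfx : f x = 1) :
    IsCompl (LinearMap.ker f) (Submodule.span R {x}) := by
  constructor
  · rw [Submodule.disjoint_def]
    intro y hy hyx
    obtain ⟨a, rfl⟩ := Submodule.mem_span_singleton.1 hyx
    have ha : a = 0 := by simpa [hfx] using hy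
    simp [ha]
  · rw [codisjoint_iff, eq_top_iff]
    intro y _
    refine Submodule.mem_sup.2 ⟨y - f y • x, by simp [hfx], f y • x,
      Submodule.smul_mem _ _ (Submodule.mem_span_singleton_self x), by simp⟩

/-- A functional taking the value `1` is surjective. -/
theorem Module.Dual.surjective_of_apply_eq_one {R M : Type*} [CommRing R] [AddCommGroup M]
    [Module R M] {f : Module.Dual R M} {x : M} (hfx : f x = 1) : Function.Surjective f :=
  fun a ↦ ⟨a • x, by simp [hfx]⟩

/-- If `End M` is free of rank one, a functional on `M` taking the value `1` is injective. -/
theorem Module.Dual.injective_of_end_equiv {R M : Type*} [CommRing R] [AddCommGroup M]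
    [Module R M] (e : (M →ₗ[R] M) ≃ₗ[R] R) {f : Module.Dual R M} {x : M} (hfx : f x = 1) :
    Function.Injective f := by
  let g : (M →ₗ[R] M) →ₗ[R] R := f ∘ₗ LinearMap.applyₗ x
  have hg : Function.Surjective g := fun a ↦ ⟨a • LinearMap.id, by simp [g, hfx]⟩
  have hge : Function.Injective (g ∘ₗ e.symm.toLinearMap) :=
    OrzechProperty.injective_of_surjective_endomorphism _ (hg.comp e.symm.surjective)
  have hginj : Function.Injective g := by
    intro a b hab
    exact e.injective (hge (by simpa using hab))
  rw [← LinearMap.ker_eq_bot, LinearMap.ker_eq_bot']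
  intro y hy
  have h0 : f.smulRight y = 0 := hginj (by simp [g, hfx, hy])
  simpa [hfx] using LinearMap.congr_fun h0 x

theorem stmt10 (R : Type) [CommRing R] [IsNoetherianRing R] [IsLocalRing R]
    (hdepth : gradeI R (maximalIdeal R) R = 0)
    (M : ModuleCat R) (hTR : TotallyReflexive R M) :
    ((Nontrivial ↥M ∧
        (∀ N N' : Submodule R ↥M, IsCompl N N' → N = ⊥ ∨ N' = ⊥) ∧
        Module.annihilator R ↥M = ⊥) →
      Nonempty (↥M ≃ₗ[R] R)) ∧
    (Nonempty ((↥M →ₗ[R] ↥M) ≃ₗ[R] R) → Nonempty (↥M ≃ₗ[R] R)) := by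
  have hrefl : Module.IsReflexive R M := hTR.2.1
  have hsoc := exists_ne_zero_forall_mul_eq_zero_of_gradeI_eq_zero R hdepth
  refine ⟨fun ⟨_, hind, hann⟩ ↦ ?_, fun ⟨e⟩ ↦ ?_⟩
  · obtain ⟨f, x, hfx⟩ := Module.IsReflexive.exists_dual_apply_eq_one hsoc hann
    refine ⟨LinearEquiv.ofBijective f
      ⟨?_, Module.Dual.surjective_of_apply_eq_one hfx⟩⟩
    rcases hind _ _ (Module.Dual.isCompl_ker_span_singleton hfx) with h | h
    · exact LinearMap.ker_eq_bot.1 h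
    · rw [Submodule.span_singleton_eq_bot] at h
      simp [h] at hfx
  · have hann : Module.annihilator R M = ⊥ := by
      refine (Submodule.eq_bot_iff _).2 fun r hr ↦ ?_
      have h0 : r • e.symm 1 = 0 := by
        ext y
        exact Module.mem_annihilator.1 hr _
      simpa using congrArg e h0
    obtain ⟨f, x, hfx⟩ := Module.IsReflexive.exists_dual_apply_eq_one hsoc hann
    exact ⟨LinearEquiv.ofBijective f ⟨Module.Dual.injective_of_end_equiv e hfx,
      Module.Dual.surjective_of_apply_eq_one hfx⟩⟩
end

section
/- Let A be an Artinian module over a Noetherian local ring (R, m). Then the injective dimension of A over R equals the injective dimension of A over the m-adic completion R̂ (with respect to the natural R̂-module structure on A). -/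
open CategoryTheory IsLocalRing Pointwise

/-- The submodule of elements of `M` annihilated by some power of `I`. -/
def Ideal.powTorsion {S : Type*} [CommRing S] (I : Ideal S) (M : Type*) [AddCommGroup M]
    [Module S M] : Submodule S M where
  carrier := {x | ∃ n : ℕ, ∀ a ∈ I ^ n, a • x = 0}
  zero_mem' := ⟨0, by simp⟩
  add_mem' := by
    rintro x y ⟨m, hm⟩ ⟨n, hn⟩
    refine ⟨max m n, fun a ha => ?_⟩
    rw [smul_add, hm a (Ideal.pow_le_pow_right (le_max_left m n) ha),
      hn a (Ideal.pow_le_pow_right (le_max_right m n) ha), add_zero]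
  smul_mem' := by
    rintro c x ⟨n, hn⟩
    exact ⟨n, fun a ha => by rw [smul_comm, hn a ha, smul_zero]⟩

theorem Ideal.mem_powTorsion {S : Type*} [CommRing S] {I : Ideal S} {M : Type*} [AddCommGroup M]
    [Module S M] {x : M} : x ∈ I.powTorsion M ↔ ∃ n : ℕ, ∀ a ∈ I ^ n, a • x = 0 :=
  Iff.rfl

theorem Ideal.exists_pow_smul_eq_zero_of_le_powTorsion {S : Type*} [CommRing S] {I : Ideal S}
    {M : Type*} [AddCommGroup M] [Module S M] {N : Submodule S M} (hN : N.FG)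
    (h : N ≤ I.powTorsion M) : ∃ n : ℕ, ∀ a ∈ I ^ n, ∀ x ∈ N, a • x = 0 := by
  induction N, hN using Submodule.fg_induction with
  | singleton x =>
    obtain ⟨n, hn⟩ := h (Submodule.mem_span_singleton_self x)
    refine ⟨n, fun a ha y hy => ?_⟩
    obtain ⟨c, rfl⟩ := Submodule.mem_span_singleton.mp hy
    rw [smul_comm, hn a ha, smul_zero]
  | sup N₁ N₂ h₁ h₂ ih₁ ih₂ =>
    obtain ⟨m, hm⟩ := ih₁ (le_sup_left.trans h)
    obtain ⟨n, hn⟩ := ih₂ (le_sup_right.trans h)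
    refine ⟨max m n, fun a ha x hx => ?_⟩
    obtain ⟨y, hy, z, hz, rfl⟩ := Submodule.mem_sup.mp hx
    rw [smul_add, hm a (Ideal.pow_le_pow_right (le_max_left m n) ha) y hy,
      hn a (Ideal.pow_le_pow_right (le_max_right m n) ha) z hz, add_zero]

/-- Over a Noetherian ring, the `I`-power torsion of an injective module is injective. -/
theorem Module.Injective.powTorsion {S : Type} [CommRing S] [IsNoetherianRing S] (I : Ideal S)
    (E : Type) [AddCommGroup E] [Module S E] (hE : Module.Injective S E) :
    Module.Injective S (I.powTorsion E) := by
  refine Module.Baer.injective fun J f => ?_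
  obtain ⟨k, hk⟩ := Ideal.exists_pow_smul_eq_zero_of_le_powTorsion (I := I)
    (N := LinearMap.range ((I.powTorsion E).subtype ∘ₗ f))
    (Module.Finite.iff_fg.mp inferInstance) (by
      rintro _ ⟨x, rfl⟩
      exact (f x).2)
  obtain ⟨c, hc⟩ := Ideal.exists_pow_inf_eq_pow_smul I J
  let φ : J →ₗ[S] S ⧸ I ^ (k + c) := (Submodule.mkQ (I ^ (k + c))) ∘ₗ J.subtype
  have hker : LinearMap.ker φ ≤ LinearMap.ker ((I.powTorsion E).subtype ∘ₗ f) := by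
    intro x hx
    have hxI : (x : S) ∈ I ^ (k + c) := by
      simpa [φ, Ideal.Quotient.eq_zero_iff_mem] using hx
    have hxJ : (x : S) ∈ I ^ k • J := by
      have h : (x : S) ∈ I ^ (k + c) • ⊤ ⊓ J := ⟨by simpa using hxI, x.2⟩
      rw [hc (k + c) (by omega), Nat.add_sub_cancel] at h
      exact (smul_mono_right (I ^ k) inf_le_right : I ^ k • (I ^ c • ⊤ ⊓ J) ≤ I ^ k • J) h
    have hmap : (I ^ k • (⊤ : Submodule S J)).map J.subtype = I ^ k • J := by
      rw [Submodule.map_smul'', Submodule.map_top, Submodule.range_subtype]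
    rw [← hmap] at hxJ
    obtain ⟨y, hy, hyx⟩ := hxJ
    obtain rfl : y = x := Subtype.ext hyx
    refine (show I ^ k • (⊤ : Submodule S J) ≤ _ from ?_) hy
    refine Submodule.smul_le.mpr fun a ha z _ => ?_
    rw [LinearMap.mem_ker, map_smul]
    exact hk a ha _ ⟨z, rfl⟩
  have hinj : Function.Injective ((LinearMap.ker φ).liftQ φ le_rfl) :=
    LinearMap.ker_eq_bot.mp (Submodule.ker_liftQ_eq_bot' _ _ rfl)
  obtain ⟨G, hG⟩ := hE.out _ hinj ((LinearMap.ker φ).liftQ _ hker)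
  refine ⟨(G ∘ₗ Submodule.mkQ (I ^ (k + c))).codRestrict (I.powTorsion E) fun x =>
    ⟨k + c, fun a ha => ?_⟩, fun x hx => Subtype.ext ?_⟩
  · rw [LinearMap.comp_apply, ← map_smul, ← map_smul,
      (Submodule.mkQ_apply _ _).trans ((Submodule.Quotient.mk_eq_zero _).mpr _), map_zero]
    exact Ideal.mul_mem_right _ _ ha
  · exact hG (Submodule.Quotient.mk ⟨x, hx⟩)

/-- Injective modules remain injective under restriction of scalars along a flat ring map. -/
theorem Module.Injective.restrictScalars_of_flat (R : Type) {S : Type} [CommRing R] [CommRing S]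
    [Algebra R S] [Module.Flat R S] {E : Type} [AddCommGroup E] [Module R E] [Module S E]
    [IsScalarTower R S E] (hE : Module.Injective S E) : Module.Injective R E := by
  refine Module.Baer.injective fun I f => ?_
  have hinj : Function.Injective (I.subtype.baseChange S) :=
    Module.Flat.lTensor_preserves_injective_linearMap (M := S) I.subtype I.subtype_injective
  obtain ⟨G, hG⟩ := hE.out _ hinj (f.liftBaseChange S)
  refine ⟨(G.restrictScalars R) ∘ₗ TensorProduct.mk R S R 1, fun x hx => ?_⟩
  simpa using hG (1 ⊗ₜ[R] ⟨x, hx⟩)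

theorem injDimLE_iff_hasInjectiveDimensionLE (S : Type) [CommRing S] (n : ℕ) (M : ModuleCat S) :
    InjDimLE S n M ↔ HasInjectiveDimensionLE M n := by
  induction n generalizing M with
  | zero =>
    rw [InjDimLE, Module.injective_iff_injective_object]
    exact injective_iff_hasInjectiveDimensionLT_one
  | succ n ih =>
    have key (E : ModuleCat S) (f : ↥M →ₗ[S] ↥E) (hf : Function.Injective f)
        (hE : Module.Injective S ↥E) :
        InjDimLE S n (ModuleCat.of S (↥E ⧸ LinearMap.range f)) ↔
          HasInjectiveDimensionLE M (n + 1) := by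
      have : Injective E := (Module.injective_iff_injective_object S E).mp hE
      rw [ih]
      exact (ModuleCat.shortComplex_shortExact
        (ModuleCat.shortComplexOfCompEqZero f (LinearMap.range f).mkQ
          f.exact_map_mkQ_range.linearMap_comp_eq_zero)
        f.exact_map_mkQ_range hf
        (Submodule.mkQ_surjective _)).hasInjectiveDimensionLT_X₃_iff n this
    constructor
    · rintro ⟨E, f, hf, hE, h⟩
      exact (key E f hf hE).mp h
    · intro h
      obtain ⟨E, hE, f, hf⟩ := EnoughInjectives.presentation M
      have hf' := (ModuleCat.mono_iff_injective f).mp hf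
      have hE' := (Module.injective_iff_injective_object S E).mpr hE
      exact ⟨E, f.hom, hf', hE', (key E f.hom hf' hE').mpr h⟩

theorem injDimLE_succ_iff_of_exact {S : Type} [CommRing S] (n : ℕ) {M E Q : Type}
    [AddCommGroup M] [Module S M] [AddCommGroup E] [Module S E] [AddCommGroup Q] [Module S Q]
    {f : M →ₗ[S] E} {g : E →ₗ[S] Q} (hfg : Function.Exact f g) (hf : Function.Injective f)
    (hg : Function.Surjective g) (hE : Module.Injective S E) :
    InjDimLE S (n + 1) (ModuleCat.of S M) ↔ InjDimLE S n (ModuleCat.of S Q) := by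
  have : Injective (ModuleCat.of S E) :=
    (Module.injective_iff_injective_object S (ModuleCat.of S E)).mp hE
  rw [injDimLE_iff_hasInjectiveDimensionLE, injDimLE_iff_hasInjectiveDimensionLE]
  exact ((ModuleCat.shortComplex_shortExact
    (ModuleCat.shortComplexOfCompEqZero f g hfg.linearMap_comp_eq_zero)
    hfg hf hg).hasInjectiveDimensionLT_X₃_iff n this).symm

theorem exists_injective_embedding (S : Type) [CommRing S] (M : Type) [AddCommGroup M]
    [Module S M] : ∃ (E : ModuleCat.{0} S) (f : M →ₗ[S] ↥E), Function.Injective f ∧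
      Module.Injective S ↥E := by
  obtain ⟨E, hE, f, hf⟩ := EnoughInjectives.presentation (ModuleCat.of S M)
  exact ⟨E, f.hom, (ModuleCat.mono_iff_injective f).mp hf,
    (Module.injective_iff_injective_object S E).mpr hE⟩

section PowTorsion

variable {R S : Type} [CommRing R] [CommRing S] [Algebra R S] {I : Ideal R}

theorem map_smul_of_powTorsion (hS : ∀ (s : S) (n : ℕ), ∃ r : R,
      s - algebraMap R S r ∈ I.map (algebraMap R S) ^ n)
    {M N : Type} [AddCommGroup M] [Module R M] [Module S M] [IsScalarTower R S M]
    [AddCommGroup N] [Module R N] [Module S N] [IsScalarTower R S N]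
    (hM : (I.map (algebraMap R S)).powTorsion M = ⊤) (f : M →ₗ[R] N) (s : S) (x : M) :
    f (s • x) = s • f x := by
  obtain ⟨n, hn⟩ := Ideal.mem_powTorsion.mp (hM ▸ Submodule.mem_top : x ∈ _)
  obtain ⟨r, hr⟩ := hS s n
  have hfx : ∀ a ∈ I.map (algebraMap R S) ^ n, a • f x = 0 := by
    have hle : I.map (algebraMap R S) ^ n ≤
        LinearMap.ker (LinearMap.toSpanSingleton S N (f x)) := by
      rw [← Ideal.map_pow, Ideal.map_le_iff_le_comap]
      intro a ha
      have := hn _ (by rw [← Ideal.map_pow]; exact Ideal.mem_map_of_mem _ ha)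
      rw [algebraMap_smul] at this
      simp [algebraMap_smul, ← map_smul, this]
    exact fun a ha => hle ha
  have h₁ := hn _ hr
  have h₂ := hfx _ hr
  rw [sub_smul, sub_eq_zero, algebraMap_smul] at h₁ h₂
  rw [h₁, h₂, map_smul]

theorem injDimLE_iff_of_powTorsion [IsNoetherianRing S] [Module.Flat R S]
    (hS : ∀ (s : S) (n : ℕ), ∃ r : R, s - algebraMap R S r ∈ I.map (algebraMap R S) ^ n)
    (n : ℕ) (M : Type) [AddCommGroup M] [Module R M] [Module S M] [IsScalarTower R S M]
    (hM : (I.map (algebraMap R S)).powTorsion M = ⊤) :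
    InjDimLE R n (ModuleCat.of R M) ↔ InjDimLE S n (ModuleCat.of S M) := by
  obtain ⟨E, i, hi, hE⟩ := exists_injective_embedding S M
  let : Module R E := Module.compHom E (algebraMap R S)
  have : IsScalarTower R S E := ⟨fun r s x => by
    rw [Algebra.smul_def, mul_smul]; rfl⟩
  set J := I.map (algebraMap R S)
  let T := J.powTorsion E
  have hT : Module.Injective S T := hE.powTorsion J E
  have hTR : Module.Injective R T := hT.restrictScalars_of_flat R
  have hTtop : J.powTorsion T = ⊤ := eq_top_iff.mpr fun x _ => by
    obtain ⟨k, hk⟩ := x.2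
    exact ⟨k, fun a ha => Subtype.ext (hk a ha)⟩
  let f : M →ₗ[S] T := i.codRestrict T fun x => by
    obtain ⟨k, hk⟩ := Ideal.mem_powTorsion.mp (hM ▸ Submodule.mem_top : x ∈ _)
    exact ⟨k, fun a ha => by rw [← map_smul, hk a ha, map_zero]⟩
  have hf : Function.Injective f := fun x y h => hi (congrArg Subtype.val h)
  cases n with
  | zero =>
    refine ⟨fun (h : Module.Injective R M) => ?_, fun (h : Module.Injective S M) =>
      h.restrictScalars_of_flat R⟩
    obtain ⟨g, hg⟩ := h.out (f.restrictScalars R) hf LinearMap.id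
    let g' : T →ₗ[S] M :=
      { g with map_smul' := fun s x => map_smul_of_powTorsion hS hTtop g s x }
    refine ⟨fun X Y _ _ _ _ u hu v => ?_⟩
    obtain ⟨w, hw⟩ := hT.out u hu (f ∘ₗ v)
    refine ⟨g' ∘ₗ w, fun x => ?_⟩
    rw [LinearMap.comp_apply, hw]
    exact hg (v x)
  | succ n =>
    let q := (LinearMap.range f).mkQ
    have hq : Function.Surjective q := Submodule.mkQ_surjective _
    have hfq : Function.Exact f q := f.exact_map_mkQ_range
    rw [injDimLE_succ_iff_of_exact n hfq hf hq hT,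
      injDimLE_succ_iff_of_exact (f := f.restrictScalars R) (g := q.restrictScalars R) n hfq hf hq
        hTR]
    refine injDimLE_iff_of_powTorsion hS n _ (eq_top_iff.mpr fun x _ => ?_)
    obtain ⟨y, rfl⟩ := hq x
    obtain ⟨k, hk⟩ := Ideal.mem_powTorsion.mp (hTtop ▸ Submodule.mem_top : y ∈ _)
    exact ⟨k, fun a ha => by rw [← map_smul, hk a ha, map_zero]⟩

end PowTorsion

namespace AdicCompletion

variable {R : Type*} [CommRing R] {I : Ideal R}

theorem exists_sub_algebraMap_mem_map_pow (hI : I.FG) (s : AdicCompletion I R) (n : ℕ) :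
    ∃ r : R, s - algebraMap R (AdicCompletion I R) r ∈
      I.map (algebraMap R (AdicCompletion I R)) ^ n := by
  obtain ⟨r, hr⟩ := Submodule.mkQ_surjective _ (eval I R n s)
  refine ⟨r, ?_⟩
  have h : s - algebraMap R (AdicCompletion I R) r ∈
      (I ^ n • ⊤ : Submodule R (AdicCompletion I R)) := by
    rw [pow_smul_top_eq_ker_eval hI, LinearMap.mem_ker, map_sub, ← hr, sub_eq_zero]
    rfl
  rw [Ideal.smul_top_eq_map] at h
  rwa [← Ideal.map_pow]

theorem isNoetherianRing [IsNoetherianRing R] (I : Ideal R) :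
    IsNoetherianRing (AdicCompletion I R) := by
  obtain ⟨s, hs⟩ := IsNoetherian.noetherian I
  have hI : I.FG := ⟨s, hs⟩
  let J := MvPolynomial.idealOfVars s R
  let φ : MvPolynomial s R →+* R := (MvPolynomial.aeval (Subtype.val : s → R)).toRingHom
  have hφ : J.map φ = I := by
    rw [Ideal.map_span, ← Set.range_comp, ← hs]
    congr 1
    ext x
    simp [φ]
  have hpow (n : ℕ) : J ^ n ≤ (I ^ n).comap φ := by
    rw [← Ideal.map_le_iff_le_comap, Ideal.map_pow, hφ]
  have : IsNoetherianRing (AdicCompletion J (MvPolynomial s R)) :=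
    isNoetherianRing_of_ringEquiv _ (MvPowerSeries.toAdicCompletionAlgEquiv s R).toRingEquiv
  let F : AdicCompletion J (MvPolynomial s R) →+* AdicCompletion I R :=
    liftRingHom I (fun n => (Ideal.quotientMap (I ^ n) φ (hpow n)).comp
      (evalₐ J n : AdicCompletion J (MvPolynomial s R) →+* MvPolynomial s R ⧸ J ^ n)) (by
        intro m n hle
        ext x
        obtain ⟨x, rfl⟩ := mk_surjective _ _ x
        have h := congrArg (Ideal.quotientMap (I ^ m) φ (hpow m)) (Ideal.mk_eq_mk J hle x)
        simpa using h)
  have hF (p : MvPolynomial s R) : F (algebraMap _ _ p) = algebraMap R _ (φ p) := by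
    refine ext_evalₐ fun n => ?_
    have h (x : AdicCompletion J (MvPolynomial s R)) :
        evalₐ I n (F x) = Ideal.quotientMap (I ^ n) φ (hpow n) (evalₐ J n x) :=
      evalₐ_liftRingHom I _ _ n x
    simp [h]
  let Jc := J.map (algebraMap (MvPolynomial s R) (AdicCompletion J (MvPolynomial s R)))
  have hJc : Jc.map F = I.map (algebraMap R (AdicCompletion I R)) := by
    rw [Ideal.map_map, show F.comp (algebraMap _ _) = (algebraMap R _).comp φ from
      RingHom.ext hF, ← Ideal.map_map, hφ]
  have : IsAdicComplete Jc (AdicCompletion J (MvPolynomial s R)) :=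
    isAdicComplete_self _ (MvPolynomial.idealOfVars_fg s R)
  have hc := isAdicComplete_self I hI
  rw [← hJc] at hc
  refine isNoetherianRing_of_surjective _ _ F
    (surjective_of_mk_map_comp_surjective (I := Jc) F fun y => ?_)
  obtain ⟨y, rfl⟩ := Ideal.Quotient.mk_surjective y
  obtain ⟨r, hr⟩ := exists_sub_algebraMap_mem_map_pow hI y 1
  refine ⟨algebraMap (MvPolynomial s R) _ (MvPolynomial.C r), ?_⟩
  rw [RingHom.comp_apply, hF, eq_comm, Ideal.Quotient.eq, hJc]
  simpa [φ] using hr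

end AdicCompletion

theorem powTorsion_maximalIdeal_eq_top (R : Type*) [CommRing R] [IsNoetherianRing R]
    [IsLocalRing R] (A : Type*) [AddCommGroup A] [Module R A] [IsArtinian R A] :
    (maximalIdeal R).powTorsion A = ⊤ := by
  refine eq_top_iff.mpr fun x _ => ?_
  let N : ℕ → Submodule R A := fun n => maximalIdeal R ^ n • (R ∙ x)
  obtain ⟨n, hn⟩ := IsArtinian.monotone_stabilizes (R := R) (M := A)
    ⟨fun n => OrderDual.toDual (N n), fun m n h =>
      Submodule.smul_mono_left (Ideal.pow_le_pow_right h)⟩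
  have hstab : N n = N (n + 1) := hn (n + 1) (Nat.le_succ n)
  have hfg : (N n).FG :=
    Submodule.FG.smul (IsNoetherian.noetherian _) (Submodule.fg_span_singleton x)
  have hbot : N n = ⊥ := Submodule.eq_bot_of_le_smul_of_le_jacobson_bot (maximalIdeal R) _ hfg
    (by
      refine hstab.le.trans_eq ?_
      simp only [N, pow_succ', mul_smul]) (maximalIdeal_le_jacobson _)
  refine ⟨n, fun a ha => ?_⟩
  have : a • x ∈ N n := Submodule.smul_mem_smul ha (Submodule.mem_span_singleton_self x)
  rwa [hbot, Submodule.mem_bot] at this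

theorem Ideal.powTorsion_map_eq_top {R S : Type*} [CommRing R] [CommRing S] [Algebra R S]
    {I : Ideal R} {M : Type*} [AddCommGroup M] [Module R M] [Module S M] [IsScalarTower R S M]
    (h : I.powTorsion M = ⊤) : (I.map (algebraMap R S)).powTorsion M = ⊤ := by
  refine eq_top_iff.mpr fun x _ => ?_
  obtain ⟨n, hn⟩ := Ideal.mem_powTorsion.mp (h ▸ Submodule.mem_top : x ∈ _)
  have hle : I.map (algebraMap R S) ^ n ≤ LinearMap.ker (LinearMap.toSpanSingleton S M x) := by
    rw [← Ideal.map_pow, Ideal.map_le_iff_le_comap]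
    intro a ha
    simp [algebraMap_smul, hn a ha]
  exact ⟨n, fun a ha => hle ha⟩

theorem stmt14 (R : Type) [CommRing R] [IsNoetherianRing R] [IsLocalRing R]
    (A : Type) [AddCommGroup A] [Module R A] [IsArtinian R A]
    [Module (AdicCompletion (maximalIdeal R) R) A]
    [IsScalarTower R (AdicCompletion (maximalIdeal R) R) A] :
    injDim R (ModuleCat.of R A) =
      injDim (AdicCompletion (maximalIdeal R) R)
        (ModuleCat.of (AdicCompletion (maximalIdeal R) R) A) := by
  have := AdicCompletion.isNoetherianRing (maximalIdeal R)
  have h (k : ℕ) := injDimLE_iff_of_powTorsion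
    (AdicCompletion.exists_sub_algebraMap_mem_map_pow (IsNoetherian.noetherian (maximalIdeal R)))
    k A (Ideal.powTorsion_map_eq_top (powTorsion_maximalIdeal_eq_top R A))
  simp only [injDim, h]
end
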